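/- Assume Conditions 1 and 2, and assume that the limit distribution p is nonlattice. Let m_κ (κ ≥ 1) be integers with 1 ≤ m_κ ≤ |n_κ| such that m_κ → ∞ and |n_κ| − m_κ → ∞ as κ → ∞. Then, as κ → ∞, E[N_{m_κ}(𝒯_{n_κ})] ∼ |n_κ| / (√(2π) · σ_p · (1 − m_κ/|n_κ|)^{1/2} · m_κ^{3/2}). Consequently: (i) if m_κ ≪ |n_κ|^{2/3} then E[N_{m_κ}(𝒯_{n_κ})] → ∞; (ii) if m_κ ∼ a·|n_κ|^{2/3} for a constant 0 < a < ∞ then E[N_{m_κ}(𝒯_{n_κ})] → (2π σ_p² a³)^{−1/2}; (iii) if m_κ ≫ |n_κ|^{2/3} then E[N_{m_κ}(𝒯_{n_κ})] → 0. -/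

import Mathlib

/-!
Common definitions: plane rooted trees, fringe subtree counts, random trees with
a given degree statistic, Poisson/normal limit notions, conditioned Galton–Watson
trees, and sampling without replacement.
-/

open Filter MeasureTheory
open scoped Topology Classical

/-- A plane rooted tree: a root together with a linearly ordered (possibly empty)
list of subtrees. Structural equality coincides with isomorphism of plane rooted trees. -/
inductive PlaneTree : Type
  | node : List PlaneTree → PlaneTree

namespace PlaneTree

/-- The (out)degree of the root: its number of children. -/
def degree : PlaneTree → ℕ
  | node ts => ts.length

mutual
  /-- The list of all fringe subtrees of a tree (one for each vertex). -/
  def fringe : PlaneTree → List PlaneTree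
    | node ts => node ts :: fringeList ts
  def fringeList : List PlaneTree → List PlaneTree
    | [] => []
    | t :: ts => fringe t ++ fringeList ts
end

/-- The number of vertices `|T|` of a plane tree. -/
def size (T : PlaneTree) : ℕ := T.fringe.length

/-- The degree statistic `n_T` of a tree: `n_T(i)` is the number of vertices with `i` children. -/
noncomputable def degStat (T : PlaneTree) : ℕ →₀ ℕ :=
  Multiset.toFinsupp ((T.fringe.map degree : List ℕ) : Multiset ℕ)

/-- `N_{T'}(T)`: the number of fringe subtrees of `T` equal to `T'`. -/
noncomputable def countTree (T' T : PlaneTree) : ℕ :=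
  (T.fringe.filter fun t => decide (t = T')).length

/-- `N_m(T)` for a degree statistic `m`: the number of fringe subtrees of `T`
with degree statistic `m`. -/
noncomputable def countStat (m : ℕ →₀ ℕ) (T : PlaneTree) : ℕ :=
  (T.fringe.filter fun t => decide (degStat t = m)).length

/-- `N_m(T)` for an integer `m`: the number of fringe subtrees of `T` of size `m`. -/
noncomputable def countSize (m : ℕ) (T : PlaneTree) : ℕ :=
  (T.fringe.filter fun t => decide (size t = m)).length

end PlaneTree

/-- `n : ℕ →₀ ℕ` is a degree statistic: `∑ n(i) = 1 + ∑ i·n(i)`. -/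
def IsDegStat (n : ℕ →₀ ℕ) : Prop :=
  (n.sum fun _ c => c) = 1 + n.sum fun i c => i * c

/-- `|n| = ∑_i n(i)`, the size of a degree statistic. -/
def nsize (n : ℕ →₀ ℕ) : ℕ := n.sum fun _ c => c

/-- The set `𝕋_n` of plane trees with degree statistic `n`. -/
def treesWith (n : ℕ →₀ ℕ) : Set PlaneTree := {T | PlaneTree.degStat T = n}

/-- `|𝕋_n|`, the number of plane trees with degree statistic `n`. -/
noncomputable def numTrees (n : ℕ →₀ ℕ) : ℕ := (treesWith n).ncard

/-- The probability that a uniformly random tree `𝒯_n ∈ 𝕋_n` satisfies `P`. -/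
noncomputable def prob (n : ℕ →₀ ℕ) (P : PlaneTree → Prop) : ℝ :=
  (({T ∈ treesWith n | P T}).ncard : ℝ) / (numTrees n : ℝ)

/-- The expectation `E[f(𝒯_n)]` of an `ℕ`-valued functional of the uniformly
random tree `𝒯_n ∈ 𝕋_n`. -/
noncomputable def expect (n : ℕ →₀ ℕ) (f : PlaneTree → ℕ) : ℝ :=
  ∑' k : ℕ, (k : ℝ) * prob n (fun T => f T = k)

/-- The variance `Var[f(𝒯_n)]`. -/
noncomputable def variance (n : ℕ →₀ ℕ) (f : PlaneTree → ℕ) : ℝ :=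
  expect n (fun T => (f T) ^ 2) - (expect n f) ^ 2

/-- The empirical degree distribution `p_i(n) = n(i)/|n|`. -/
noncomputable def empDist (n : ℕ →₀ ℕ) (i : ℕ) : ℝ := (n i : ℝ) / (nsize n : ℝ)

/-- `π_p(T) = ∏_{i ≥ 0} p_i^{n_T(i)}`. -/
noncomputable def piDist (p : ℕ → ℝ) (T : PlaneTree) : ℝ :=
  (PlaneTree.degStat T).prod fun i c => p i ^ c

/-- `π_p(𝕋_m) = |𝕋_m| · ∏_{i ≥ 0} p_i^{m(i)}`. -/
noncomputable def piSet (p : ℕ → ℝ) (m : ℕ →₀ ℕ) : ℝ :=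
  (numTrees m : ℝ) * m.prod fun i c => p i ^ c

/-- Condition 1: the `nseq κ` are degree statistics with `|n_κ| → ∞` and
`p_i(n_κ) → p_i` for every `i`, where `p` is a probability distribution on `ℕ`. -/
def Condition1 (nseq : ℕ → (ℕ →₀ ℕ)) (p : ℕ → ℝ) : Prop :=
  (∀ κ, IsDegStat (nseq κ)) ∧
  Tendsto (fun κ => nsize (nseq κ)) atTop atTop ∧
  (∀ i, 0 ≤ p i) ∧ HasSum p 1 ∧
  (∀ i, Tendsto (fun κ => empDist (nseq κ) i) atTop (𝓝 (p i)))

/-- Condition 2: in addition, `∑ i² p_i(n_κ) → ∑ i² p_i < ∞`. -/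
def Condition2 (nseq : ℕ → (ℕ →₀ ℕ)) (p : ℕ → ℝ) : Prop :=
  Summable (fun i : ℕ => (i : ℝ) ^ 2 * p i) ∧
  Tendsto (fun κ => ∑' i : ℕ, (i : ℝ) ^ 2 * empDist (nseq κ) i) atTop
    (𝓝 (∑' i : ℕ, (i : ℝ) ^ 2 * p i))

/-- `σ_p² = ∑_{i ≥ 0} (i-1)² p_i`. -/
noncomputable def sigmaSq (p : ℕ → ℝ) : ℝ := ∑' i : ℕ, ((i : ℝ) - 1) ^ 2 * p i

/-- The point probabilities of the Poisson distribution `Po(lam)`. -/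
noncomputable def poissonPMF (lam : ℝ) (k : ℕ) : ℝ :=
  Real.exp (-lam) * lam ^ k / (Nat.factorial k : ℝ)

/-- The `q`-th moment of the Poisson distribution `Po(lam)`. -/
noncomputable def poissonMoment (lam : ℝ) (q : ℕ) : ℝ :=
  ∑' k : ℕ, (k : ℝ) ^ q * poissonPMF lam k

/-- The standard normal cumulative distribution function. -/
noncomputable def stdNormalCDF (x : ℝ) : ℝ :=
  ∫ t in Set.Iic x, Real.exp (-t ^ 2 / 2) / Real.sqrt (2 * Real.pi)

/-- The total variation distance between the law of `f(𝒯_n)` and `Po(lam)`: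
`sup_A |P(f(𝒯_n) ∈ A) − Po(lam)(A)|`. -/
noncomputable def dTVPoisson (n : ℕ →₀ ℕ) (f : PlaneTree → ℕ) (lam : ℝ) : ℝ :=
  ⨆ A : Set ℕ, |prob n (fun T => f T ∈ A) - ∑' k : ℕ, A.indicator (poissonPMF lam) k|

/-- A probability distribution on `ℕ` is nonlattice: the gcd of the differences of
points of its support is `1`. -/
def Nonlattice (p : ℕ → ℝ) : Prop :=
  ∀ h : ℕ, (∀ i j : ℕ, 0 < p i → 0 < p j → (h : ℤ) ∣ (i : ℤ) - (j : ℤ)) → h = 1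

/-- The partition function `P(|𝒯_p| = n)` of a Galton–Watson tree with offspring
distribution `p`. -/
noncomputable def gwZ (p : ℕ → ℝ) (n : ℕ) : ℝ :=
  ∑' T : PlaneTree, if PlaneTree.size T = n then piDist p T else 0

/-- `P(𝒯_{p,n} ∈ {T | P T})` for the conditioned Galton–Watson tree `𝒯_{p,n}`. -/
noncomputable def probGW (p : ℕ → ℝ) (n : ℕ) (P : PlaneTree → Prop) : ℝ :=
  (∑' T : PlaneTree, if PlaneTree.size T = n ∧ P T then piDist p T else 0) / gwZ p n

/-- The expectation `E[f(𝒯_{p,n})]` for an `ℕ`-valued functional. -/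
noncomputable def expectGW (p : ℕ → ℝ) (n : ℕ) (f : PlaneTree → ℕ) : ℝ :=
  ∑' k : ℕ, (k : ℝ) * probGW p n (fun T => f T = k)

/-- The filter `n → ∞` along the sizes `n` for which the conditioning `|𝒯_p| = n`
is well defined. -/
noncomputable def gwFilter (p : ℕ → ℝ) : Filter ℕ :=
  atTop ⊓ Filter.principal {n | 0 < gwZ p n}

/-- A positive function on the positive reals is slowly varying at infinity. -/
def SlowlyVarying (L : ℝ → ℝ) : Prop :=
  (∀ x : ℝ, 0 < x → 0 < L x) ∧
  ∀ c : ℝ, 0 < c → Tendsto (fun x : ℝ => L (c * x) / L x) atTop (𝓝 1)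

/-- The probability that a uniformly random permutation of `Fin n` satisfies `P`. -/
noncomputable def probPerm {n : ℕ} (P : Equiv.Perm (Fin n) → Prop) : ℝ :=
  ((Finset.univ.filter P).card : ℝ) / ((Finset.univ : Finset (Equiv.Perm (Fin n))).card : ℝ)

/-- `S_m = ∑_{i=1}^m d_{τ(i)}`: the sum of `m` of the values `d`, drawn without
replacement via the permutation `τ`. -/
def sampleSum {n : ℕ} (d : Fin n → ℤ) (m : ℕ) (τ : Equiv.Perm (Fin n)) : ℤ :=
  ∑ i : Fin n, if (i : ℕ) < m then d (τ i) else 0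

/-- The mean `d̄` of the values `d`. -/
noncomputable def dbar {n : ℕ} (d : Fin n → ℤ) : ℝ := (∑ i : Fin n, (d i : ℝ)) / n

/-- `Q = ∑_i (d_i − d̄)²`. -/
noncomputable def Qval {n : ℕ} (d : Fin n → ℤ) : ℝ := ∑ i : Fin n, ((d i : ℝ) - dbar d) ^ 2

/-- `σ̂² = (m/n)(1 − m/n) Q`. -/
noncomputable def sigHatSq {n : ℕ} (d : Fin n → ℤ) (m : ℕ) : ℝ :=
  ((m : ℝ) / n) * (1 - (m : ℝ) / n) * Qval d

/-- The empirical frequency `p_k(d) = #{i : d_i = k}/n`. -/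
noncomputable def empFreq {n : ℕ} (d : Fin n → ℤ) (k : ℤ) : ℝ :=
  ((Finset.univ.filter (fun i => d i = k)).card : ℝ) / n

/-- The characteristic function `φ_{S_m}(t) = E[exp(i t S_m)]` of the sample sum. -/
noncomputable def charFn {n : ℕ} (d : Fin n → ℤ) (m : ℕ) (t : ℝ) : ℂ :=
  (Fintype.card (Equiv.Perm (Fin n)) : ℂ)⁻¹ *
    ∑ τ : Equiv.Perm (Fin n), Complex.exp (Complex.I * t * (sampleSum d m τ : ℂ))

/-- A probability distribution on `ℤ` is nonlattice. -/
def NonlatticeZ (p : ℤ → ℝ) : Prop :=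
  ∀ h : ℕ, (∀ i j : ℤ, 0 < p i → 0 < p j → (h : ℤ) ∣ i - j) → h = 1

namespace PlaneTree

/-- The preorder sequence of outdegrees of a plane tree. -/
def word (T : PlaneTree) : List ℕ := T.fringe.map degree

/-- The concatenated preorder outdegree sequences of a plane forest. -/
def forestWord (ts : List PlaneTree) : List ℕ := (fringeList ts).map degree

lemma fringeList_append (us ts : List PlaneTree) :
    fringeList (us ++ ts) = fringeList us ++ fringeList ts := by
  induction us with
  | nil => simp [fringeList]
  | cons u us ih => simp [fringeList, ih]

lemma fringeList_node_cons (us ts : List PlaneTree) :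
    fringeList (node us :: ts) = node us :: fringeList (us ++ ts) := by
  simp [fringeList, fringe, fringeList_append]

lemma forestWord_nil : forestWord [] = [] := by
  simp [forestWord, fringeList]

lemma forestWord_append (us ts : List PlaneTree) :
    forestWord (us ++ ts) = forestWord us ++ forestWord ts := by
  simp [forestWord, fringeList_append]

lemma forestWord_node_cons (us ts : List PlaneTree) :
    forestWord (node us :: ts) = us.length :: forestWord (us ++ ts) := by
  simp [forestWord, fringeList_node_cons, degree]

lemma forestWord_singleton (T : PlaneTree) : forestWord [T] = T.word := by
  simp [forestWord, word, fringeList]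

lemma word_node (us : List PlaneTree) : (node us).word = us.length :: forestWord us := by
  simp [word, forestWord, fringe, degree]

lemma length_word (T : PlaneTree) : T.word.length = T.size := by
  simp [word, size]

/-- Induction over plane forests which removes the root of the first tree. -/
lemma forest_induction {P : List PlaneTree → Prop} (nil : P [])
    (cons : ∀ us ts, P (us ++ ts) → P (node us :: ts)) (ts : List PlaneTree) : P ts := by
  induction h : (forestWord ts).length using Nat.strong_induction_on generalizing ts with
  | _ k ih =>
    match ts with
    | [] => exact nil
    | node us :: ts =>
      rw [forestWord_node_cons] at h
      exact cons us ts (ih _ (by rw [← h]; simp) _ rfl)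

lemma sum_forestWord (ts : List PlaneTree) :
    (forestWord ts).sum + ts.length = (forestWord ts).length := by
  induction ts using forest_induction with
  | nil => simp [forestWord_nil]
  | cons us ts ih =>
    rw [forestWord_node_cons]
    simp only [List.length_append, List.sum_cons, List.length_cons] at ih ⊢
    omega

lemma sum_word (T : PlaneTree) : T.word.sum + 1 = T.word.length := by
  simpa [forestWord_singleton] using sum_forestWord [T]

lemma sum_take_forestWord (ts : List PlaneTree) (k : ℕ) (hk : k < (forestWord ts).length) :
    k < ((forestWord ts).take k).sum + ts.length := by
  induction ts using forest_induction generalizing k with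
  | nil => simp [forestWord_nil] at hk
  | cons us ts ih =>
    rw [forestWord_node_cons] at hk ⊢
    cases k with
    | zero => simp
    | succ k =>
      have := ih k (by simpa using hk)
      simp only [List.length_append, List.take_succ_cons, List.sum_cons, List.length_cons] at this ⊢
      omega

lemma sum_take_word (T : PlaneTree) (k : ℕ) (hk : k < T.word.length) :
    k ≤ (T.word.take k).sum := by
  have := sum_take_forestWord [T] k (by simpa [forestWord_singleton] using hk)
  rw [forestWord_singleton] at this
  simp at this
  omega

lemma exists_forestWord_eq (w : List ℕ) (k : ℕ) (hw : w.sum + k = w.length)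
    (hpre : ∀ j < w.length, j < (w.take j).sum + k) :
    ∃ ts : List PlaneTree, ts.length = k ∧ forestWord ts = w := by
  induction w generalizing k with
  | nil => exact ⟨[], by simpa using hw.symm, forestWord_nil⟩
  | cons a w ih =>
    have hk : 0 < k := by simpa using hpre 0 (by simp)
    obtain ⟨ts, hts, rfl⟩ := ih (k - 1 + a)
      (by simp only [List.sum_cons, List.length_cons] at hw; omega)
      (fun j hj => by
        have := hpre (j + 1) (by simpa using hj)
        simp only [List.take_succ_cons, List.sum_cons] at this
        omega)
    refine ⟨node (ts.take a) :: ts.drop a, ?_, ?_⟩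
    · simp only [List.length_cons, List.length_drop]; omega
    · rw [forestWord_node_cons, List.take_append_drop, List.length_take, hts,
        min_eq_left (by omega)]

lemma exists_word_eq (w : List ℕ) (hw : w.sum + 1 = w.length)
    (hpre : ∀ j < w.length, j ≤ (w.take j).sum) : ∃ T : PlaneTree, T.word = w := by
  obtain ⟨ts, hts, h⟩ := exists_forestWord_eq w 1 hw
    (fun j hj => Nat.lt_succ_of_le (hpre j hj))
  obtain ⟨T, rfl⟩ := List.length_eq_one_iff.1 hts
  exact ⟨T, by rw [← forestWord_singleton, h]⟩

lemma forestWord_append_inj (ts : List PlaneTree) :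
    ∀ (ts' : List PlaneTree) (r r' : List ℕ), ts.length = ts'.length →
      forestWord ts ++ r = forestWord ts' ++ r' → ts = ts' := by
  induction ts using forest_induction with
  | nil => 
    intro ts' r r' h _
    exact (List.length_eq_zero_iff.1 h.symm).symm
  | cons us ts ih =>
    intro ts' r r' hl h
    match ts' with
    | [] => simp at hl
    | node us' :: ts' =>
      rw [forestWord_node_cons, forestWord_node_cons] at h
      simp only [List.cons_append, List.cons.injEq] at h
      have := ih (us' ++ ts') r r' (by simp at hl ⊢; omega) h.2
      obtain ⟨h1, h2⟩ := List.append_inj this h.1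
      rw [h1, h2]

lemma eq_of_word_isPrefix {T T' : PlaneTree} {w : List ℕ} (h : T.word <+: w)
    (h' : T'.word <+: w) :
    T = T' := by
  obtain ⟨r, rfl⟩ := h
  obtain ⟨r', h'⟩ := h'
  simpa using forestWord_append_inj [T] [T'] r r' rfl
    (by simpa [forestWord_singleton] using h'.symm)

lemma word_injective : Function.Injective word := fun T _ h =>
  eq_of_word_isPrefix (List.prefix_refl T.word) (h ▸ List.prefix_refl _)

lemma word_fringeList_isPrefix (ts : List PlaneTree) :
    ∀ (i : ℕ) (hi : i < (fringeList ts).length),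
      ((fringeList ts)[i]).word <+: (forestWord ts).drop i := by
  induction ts using forest_induction with
  | nil => intro i hi; simp [fringeList] at hi
  | cons us ts ih =>
    intro i hi
    simp only [fringeList_node_cons, forestWord_node_cons]
    cases i with
    | zero =>
      simp only [List.getElem_cons_zero, List.drop_zero, word_node, forestWord_append]
      exact ⟨forestWord ts, by simp⟩
    | succ i =>
      simpa using ih i (by simpa [fringeList_node_cons] using hi)

lemma word_fringe_isPrefix (T : PlaneTree) (i : ℕ) (hi : i < T.fringe.length) :
    (T.fringe[i]).word <+: T.word.rotate i := by
  have h := word_fringeList_isPrefix [T] i (by simpa [fringeList] using hi)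
  rw [forestWord_singleton] at h
  rw [List.rotate_eq_drop_append_take (by simpa [length_word, size] using hi.le)]
  simp only [fringeList, List.append_nil] at h
  exact h.trans (List.prefix_append _ _)

/-- A list of natural numbers is a tree word if it is the preorder outdegree sequence of a
plane tree. -/
def IsTreeWord (w : List ℕ) : Prop := ∃ T : PlaneTree, T.word = w

lemma size_fringe_eq_iff (T : PlaneTree) (i m : ℕ) (hi : i < T.fringe.length)
    (hm : m ≤ T.size) :
    (T.fringe[i]).size = m ↔ IsTreeWord ((T.word.rotate i).take m) := by
  have h := word_fringe_isPrefix T i hi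
  constructor
  · intro hs
    refine ⟨T.fringe[i], ?_⟩
    rw [← hs, ← length_word]
    exact (List.prefix_iff_eq_take.1 h)
  · rintro ⟨T', hT'⟩
    have h2 : T'.word <+: T.word.rotate i := hT' ▸ ⟨_, List.take_append_drop m _⟩
    rw [eq_of_word_isPrefix h h2, ← length_word, hT', List.length_take, List.length_rotate,
      length_word]
    omega

lemma countSize_eq_sum (T : PlaneTree) (m : ℕ) (hm : m ≤ T.size) :
    countSize m T = ∑ i ∈ Finset.range T.size,
      if IsTreeWord ((T.word.rotate i).take m) then 1 else 0 := by
  have key : ∀ (l : List PlaneTree) (P : PlaneTree → Prop) [DecidablePred P],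
      (l.filter fun t => decide (P t)).length =
        ∑ i ∈ Finset.range l.length, if h : i < l.length then (if P l[i] then 1 else 0) else 0 := by
    intro l P _
    induction l with
    | nil => simp
    | cons a l ih =>
      simp only [List.length_cons]
      rw [Finset.sum_range_succ', List.filter_cons]
      by_cases h : P a <;> simp [h, ih]
  rw [countSize, key]
  change ∑ i ∈ Finset.range T.size, _ = _
  refine Finset.sum_congr rfl fun i hi => ?_
  have hi' : i < T.fringe.length := Finset.mem_range.1 hi
  simp [hi', size_fringe_eq_iff T i m hi' hm]

lemma isTreeWord_iff (w : List ℕ) :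
    IsTreeWord w ↔ w.sum + 1 = w.length ∧ ∀ j < w.length, j ≤ (w.take j).sum := by
  constructor
  · rintro ⟨T, rfl⟩
    exact ⟨sum_word T, sum_take_word T⟩
  · rintro ⟨h1, h2⟩
    exact exists_word_eq w h1 h2

lemma isTreeWord_rotate_iff (w : List ℕ) (hw : w.sum + 1 = w.length) (r : ℕ)
    (hr : r < w.length) :
    IsTreeWord (w.rotate r) ↔
      (∀ k < r, ((w.take r).sum : ℤ) - r < (w.take k).sum - k) ∧
        ∀ k < w.length, r ≤ k → ((w.take r).sum : ℤ) - r ≤ (w.take k).sum - k := by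
  have hsum : (w.rotate r).sum = w.sum := (List.rotate_perm w r).sum_eq
  have hlow : ∀ j, r + j ≤ w.length →
      ((w.rotate r).take j).sum + (w.take r).sum = (w.take (r + j)).sum := by
    intro j hj
    rw [List.rotate_eq_drop_append_take hr.le, List.take_append_of_le_length (by simp; omega),
      List.take_add, List.sum_append, add_comm]
  have hhigh : ∀ k ≤ r, ((w.rotate r).take (w.length - r + k)).sum + (w.take r).sum =
      w.sum + (w.take k).sum := by
    intro k hk
    rw [List.rotate_eq_drop_append_take hr.le, List.take_append, List.take_of_length_le (by simp)]
    simp only [List.length_drop, List.sum_append, add_tsub_cancel_left, List.take_take,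
      min_eq_left hk]
    have := congrArg List.sum (List.take_append_drop r w)
    rw [List.sum_append] at this
    omega
  rw [isTreeWord_iff, hsum, List.length_rotate]
  constructor
  · rintro ⟨-, h⟩
    constructor
    · intro k hk
      have h1 := h (w.length - r + k) (by omega)
      have h2 := hhigh k hk.le
      omega
    · intro k hk hrk
      have h1 := h (k - r) (by omega)
      have h2 := hlow (k - r) (by omega)
      rw [Nat.add_sub_cancel' hrk] at h2
      omega
  · rintro ⟨h1, h2⟩
    refine ⟨hw, fun j hj => ?_⟩
    rcases lt_or_ge (r + j) w.length with h | h
    · have h3 := h2 (r + j) h (by omega)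
      have h4 := hlow j h.le
      omega
    · obtain ⟨k, rfl⟩ : ∃ k, j = w.length - r + k := ⟨j - (w.length - r), by omega⟩
      have h3 := h1 k (by omega)
      have h4 := hhigh k (by omega)
      omega

/-- The cycle lemma. -/
lemma existsUnique_isTreeWord_rotate (w : List ℕ) (hw : w.sum + 1 = w.length) :
    ∃! r, r < w.length ∧ IsTreeWord (w.rotate r) := by
  set S : ℕ → ℤ := fun k => (w.take k).sum - k with hS
  have hex : ∃ r, r < w.length ∧ ∀ k < w.length, S r ≤ S k := by
    obtain ⟨r, hr, h⟩ := Finset.exists_min_image (Finset.range w.length) S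
      ⟨0, by simp; omega⟩
    exact ⟨r, by simpa using hr, fun k hk => h k (by simpa using hk)⟩
  refine ⟨Nat.find hex, ⟨(Nat.find_spec hex).1, ?_⟩, ?_⟩
  · rw [isTreeWord_rotate_iff w hw _ (Nat.find_spec hex).1]
    refine ⟨fun k hk => ?_, fun k hk _ => (Nat.find_spec hex).2 k hk⟩
    by_contra! hcon
    refine Nat.find_min hex hk ⟨hk.trans (Nat.find_spec hex).1, fun j hj => ?_⟩
    exact hcon.trans ((Nat.find_spec hex).2 j hj)
  · rintro r ⟨hr, hT⟩
    rw [isTreeWord_rotate_iff w hw _ hr] at hT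
    rcases lt_trichotomy r (Nat.find hex) with h | h | h
    · exact absurd ⟨hr, fun k hk => (hT.2 _ (Nat.find_spec hex).1 h.le).trans
        ((Nat.find_spec hex).2 k hk)⟩ (Nat.find_min hex h)
    · exact h
    · exact absurd (hT.1 _ h) (not_lt.2 ((Nat.find_spec hex).2 r hr))

lemma sum_isTreeWord_rotate (w : List ℕ) (hw : w.sum + 1 = w.length) :
    (∑ r ∈ Finset.range w.length, if IsTreeWord (w.rotate r) then 1 else 0) = 1 := by
  obtain ⟨r, ⟨hr, hT⟩, huniq⟩ := existsUnique_isTreeWord_rotate w hw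
  rw [Finset.sum_eq_single_of_mem r (Finset.mem_range.2 hr), if_pos hT]
  intro k hk hne
  rw [if_neg]
  exact fun h => hne (huniq k ⟨Finset.mem_range.1 hk, h⟩)

/-- The lists whose underlying multiset is `s`. -/
noncomputable def words (s : Multiset ℕ) : Finset (List ℕ) := s.lists.toFinset

lemma mem_words_iff (s : Multiset ℕ) (w : List ℕ) : w ∈ words s ↔ (w : Multiset ℕ) = s := by
  rw [words, Multiset.mem_toFinset, Multiset.mem_lists_iff, eq_comm]; rfl

lemma length_of_mem_words {s : Multiset ℕ} {w : List ℕ} (h : w ∈ words s) :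
    w.length = s.card := by
  rw [mem_words_iff] at h; rw [← h]; rfl

lemma sum_of_mem_words {s : Multiset ℕ} {w : List ℕ} (h : w ∈ words s) :
    w.sum = s.sum := by
  rw [mem_words_iff] at h; rw [← h]; rfl

lemma mem_words_of_perm {s : Multiset ℕ} {w w' : List ℕ} (h : w ∈ words s) (hp : w'.Perm w) :
    w' ∈ words s := by
  rw [mem_words_iff] at h ⊢; rw [← h]; exact Multiset.coe_eq_coe.2 hp

/-- Summing a functional over all rotations of all tree words with letters `s` amounts to
summing it over all words with letters `s`. -/
lemma sum_isTreeWord_sum_rotate (s : Multiset ℕ) (hs : s.sum + 1 = s.card) (F : List ℕ → ℕ) :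
    (∑ w ∈ words s with IsTreeWord w, ∑ i ∈ Finset.range s.card, F (w.rotate i)) =
      ∑ w ∈ words s, F w := by
  have hreflect : ∀ w ∈ words s, ∑ i ∈ Finset.range s.card, F (w.rotate i) =
      ∑ i ∈ Finset.range s.card, F (w.rotate (s.card - i)) := by
    intro w hw
    rw [← Finset.sum_range_reflect (fun i => F (w.rotate (s.card - i)))]
    obtain ⟨N, hN⟩ : ∃ N, s.card = N + 1 := ⟨s.sum, hs.symm⟩
    have h1 : ∀ i ∈ Finset.range (N + 1), F (w.rotate (N + 1 - (N + 1 - 1 - i))) =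
        F (w.rotate (i + 1)) := by
      intro i hi
      rw [Finset.mem_range] at hi
      congr 2; omega
    rw [hN, Finset.sum_congr rfl h1, Finset.sum_range_succ', Finset.sum_range_succ,
      ← hN, ← length_of_mem_words hw, List.rotate_length, List.rotate_zero]
  calc _ = ∑ w ∈ words s, ∑ i ∈ Finset.range s.card,
        if IsTreeWord w then F (w.rotate (s.card - i)) else 0 := by
        rw [Finset.sum_filter]
        refine Finset.sum_congr rfl fun w hw => ?_
        rw [hreflect w hw]
        split_ifs <;> simp
    _ = ∑ i ∈ Finset.range s.card, ∑ w ∈ words s,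
        if IsTreeWord w then F (w.rotate (s.card - i)) else 0 := Finset.sum_comm
    _ = ∑ i ∈ Finset.range s.card, ∑ w ∈ words s,
        if IsTreeWord (w.rotate i) then F w else 0 := by
        refine Finset.sum_congr rfl fun i hi => ?_
        have hi := (Finset.mem_range.1 hi).le
        refine Finset.sum_nbij' (fun w => w.rotate (s.card - i)) (fun w => w.rotate i)
          (fun w hw => mem_words_of_perm hw (List.rotate_perm _ _))
          (fun w hw => mem_words_of_perm hw (List.rotate_perm _ _)) ?_ ?_ ?_
        · intro w hw
          simp only [List.rotate_rotate]
          rw [Nat.sub_add_cancel hi, ← length_of_mem_words hw, List.rotate_length]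
        · intro w hw
          simp only [List.rotate_rotate]
          rw [Nat.add_sub_cancel' hi, ← length_of_mem_words hw, List.rotate_length]
        · intro w hw
          simp only [List.rotate_rotate]
          rw [Nat.sub_add_cancel hi, ← length_of_mem_words hw, List.rotate_length]
    _ = ∑ w ∈ words s, F w * ∑ i ∈ Finset.range s.card,
          if IsTreeWord (w.rotate i) then 1 else 0 := by
        rw [Finset.sum_comm]
        refine Finset.sum_congr rfl fun w hw => ?_
        rw [Finset.mul_sum]
        simp
    _ = _ := by
        refine Finset.sum_congr rfl fun w hw => ?_
        have := sum_isTreeWord_rotate w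
          (by rw [sum_of_mem_words hw, length_of_mem_words hw, hs])
        rw [length_of_mem_words hw] at this
        rw [this, mul_one]

/-- The cycle lemma applied to the first `m` letters of all words with letters `s`. -/
lemma sum_isTreeWord_take (s : Multiset ℕ) (m : ℕ) (hm : m ≤ s.card) :
    m * (∑ w ∈ words s, if IsTreeWord (w.take m) then 1 else 0) =
      ∑ w ∈ words s, if (w.take m).sum + 1 = m then 1 else 0 := by
  have hlen : ∀ w ∈ words s, (w.take m).length = m := fun w hw => by
    rw [List.length_take, length_of_mem_words hw, min_eq_left hm]
  have hbij : ∀ i ≤ m, ∀ w ∈ words s, ((w.take m).rotate i ++ w.drop m) ∈ words s := by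
    intro i _ w hw
    refine mem_words_of_perm hw ?_
    conv_rhs => rw [← List.take_append_drop m w]
    exact (List.rotate_perm _ _).append_right _
  have htake : ∀ i, ∀ w ∈ words s, ((w.take m).rotate i ++ w.drop m).take m =
      (w.take m).rotate i := fun i w hw =>
    List.take_left' (by rw [List.length_rotate, hlen w hw])
  have hdrop : ∀ i, ∀ w ∈ words s, ((w.take m).rotate i ++ w.drop m).drop m =
      w.drop m := fun i w hw =>
    List.drop_left' (by rw [List.length_rotate, hlen w hw])
  have hinv : ∀ i j, i + j = m → ∀ w ∈ words s,
      (((w.take m).rotate i ++ w.drop m).take m).rotate j ++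
        ((w.take m).rotate i ++ w.drop m).drop m = w := by
    intro i j hij w hw
    rw [htake i w hw, hdrop i w hw, List.rotate_rotate, hij]
    have : (w.take m).rotate m = w.take m := by
      have := List.rotate_length (w.take m)
      rwa [hlen w hw] at this
    rw [this, List.take_append_drop]
  symm
  calc _ = ∑ w ∈ words s, ∑ i ∈ Finset.range m,
        if IsTreeWord ((w.take m).rotate i) then 1 else 0 := by
        refine Finset.sum_congr rfl fun w hw => ?_
        split_ifs with h
        · have := sum_isTreeWord_rotate (w.take m) (by rw [hlen w hw, h])
          rw [hlen w hw] at this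
          exact this.symm
        · symm
          refine Finset.sum_eq_zero fun i _ => if_neg fun hT => h ?_
          have := ((isTreeWord_iff _).1 hT).1
          rwa [List.length_rotate, (List.rotate_perm _ _).sum_eq, hlen w hw] at this
    _ = ∑ i ∈ Finset.range m, ∑ w ∈ words s,
        if IsTreeWord ((w.take m).rotate i) then 1 else 0 := Finset.sum_comm
    _ = ∑ i ∈ Finset.range m, ∑ w ∈ words s,
        if IsTreeWord (w.take m) then 1 else 0 := by
        refine Finset.sum_congr rfl fun i hi => ?_
        have hi := (Finset.mem_range.1 hi).le
        refine Finset.sum_nbij' (fun w => (w.take m).rotate i ++ w.drop m)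
          (fun w => (w.take m).rotate (m - i) ++ w.drop m)
          (hbij i hi) (hbij (m - i) (Nat.sub_le _ _)) (hinv i (m - i) (by omega))
          (hinv (m - i) i (by omega)) ?_
        intro w hw
        simp only [htake i w hw]
    _ = _ := by simp

lemma exists_perm_getElem {w w' : List ℕ} (h : w.Perm w') (N : ℕ) (hN : w.length = N) :
    ∃ σ : Equiv.Perm (Fin N), ∀ i : Fin N, w'.getD (σ i) 0 = w.getD i 0 := by
  have hlt : ∀ i : Fin N, (i : ℕ) < w.length := fun i => by omega
  have hlt' : ∀ i : Fin N, (i : ℕ) < w'.length := fun i => by rw [← h.length_eq]; omega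
  let e := Equiv.ofBijective _ ⟨List.Perm.idxBij_injective h, List.Perm.idxBij_surjective h⟩
  refine ⟨(finCongr hN.symm).trans (e.trans (finCongr (h.length_eq.symm.trans hN))), fun i => ?_⟩
  have := List.Perm.getElem_idxBij_eq_getElem h ⟨i, hlt i⟩
  rw [List.getD_eq_getElem _ _ (hlt i), List.getD_eq_getElem _ _ (hlt' _)]
  exact this
lemma ofFn_getD (w : List ℕ) (N : ℕ) (hN : w.length = N) :
    List.ofFn (fun i : Fin N => w.getD i 0) = w := by
  subst hN
  simp

lemma sum_getD_lt_eq_sum_take (w : List ℕ) (N m : ℕ) (hm : m ≤ N) :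
    ∑ i ∈ (Finset.univ : Finset (Fin N)).filter (fun i : Fin N => (i : ℕ) < m), w.getD i 0 = (w.take m).sum := by
  have h1 : ∀ (w : List ℕ) (m : ℕ), ∑ i ∈ Finset.range m, w.getD i 0 = (w.take m).sum := by
    intro w
    induction w with
    | nil => simp
    | cons a w ih =>
      intro m
      cases m with
      | zero => simp
      | succ m =>
        rw [Finset.sum_range_succ', List.take_succ_cons, List.sum_cons, ← ih, add_comm]
        simp
  rw [← h1, Finset.sum_filter, Fin.sum_univ_eq_sum_range (fun i => if i < m then w.getD i 0 else 0),
    ← Finset.sum_filter]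
  congr 1
  ext i
  simp; omega

/-- Double counting of the pairs of a word with letters `s` and a set of `m` positions. -/
lemma choose_mul_sum_take (s : Multiset ℕ) (m : ℕ) (hm : m ≤ s.card) (w₀ : List ℕ)
    (hw₀ : w₀ ∈ words s) :
    s.card.choose m * (∑ w ∈ words s, if (w.take m).sum + 1 = m then 1 else 0) =
      (words s).card * ((Finset.univ : Finset (Fin s.card)).powersetCard m |>.filter
        fun A : Finset (Fin s.card) => ∑ j ∈ A, w₀.getD j 0 + 1 = m).card := by
  set N := s.card with hN
  set act : Equiv.Perm (Fin N) → List ℕ → List ℕ :=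
    fun σ w => List.ofFn (fun j : Fin N => w.getD (σ j) 0) with hact
  have hget : ∀ σ w (j : Fin N), (act σ w).getD j 0 = w.getD (σ j) 0 := by
    intro σ w j
    simp [hact]
  have hmem : ∀ σ, ∀ w ∈ words s, act σ w ∈ words s := by
    intro σ w hw
    refine mem_words_of_perm hw ?_
    have := Equiv.Perm.ofFn_comp_perm σ (fun j : Fin N => w.getD j 0)
    rwa [ofFn_getD w N (length_of_mem_words hw)] at this
  have hinv : ∀ σ τ : Equiv.Perm (Fin N), (∀ j, σ (τ j) = j) → ∀ w ∈ words s,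
      act τ (act σ w) = w := by
    intro σ τ h w hw
    conv_rhs => rw [← ofFn_getD w N (length_of_mem_words hw)]
    change List.ofFn (fun j : Fin N => (act σ w).getD (τ j) 0) = _
    congr 1
    funext j
    have := hget σ w (τ j)
    rw [h] at this
    exact this
  have h1 : ∀ A ∈ (Finset.univ : Finset (Fin N)).powersetCard m,
      (∑ w ∈ words s, if ∑ j ∈ A, w.getD j 0 + 1 = m then 1 else 0) =
        ∑ w ∈ words s, if (w.take m).sum + 1 = m then 1 else 0 := by
    intro A hA
    rw [Finset.mem_powersetCard] at hA
    have hcard : (Finset.univ.filter fun i : Fin N => (i : ℕ) < m).card = A.card := by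
      rw [hA.2, Fin.card_filter_val_lt, min_eq_right hm]
    obtain ⟨σ, hσ⟩ := Equiv.Perm.exists_map_finset_eq _ _ hcard
    refine Finset.sum_nbij' (act σ) (act σ.symm) (hmem σ) (hmem _)
      (hinv _ _ (by simp)) (hinv _ _ (by simp)) ?_
    intro w hw
    rw [← sum_getD_lt_eq_sum_take _ N m hm, ← hσ, Finset.sum_map]
    simp only [hget, Equiv.toEmbedding_apply]
  have h2 : ∀ w ∈ words s,
      (∑ A ∈ (Finset.univ : Finset (Fin N)).powersetCard m,
        if ∑ j ∈ A, w.getD j 0 + 1 = m then 1 else 0) =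
      ∑ A ∈ (Finset.univ : Finset (Fin N)).powersetCard m,
        if ∑ j ∈ A, w₀.getD j 0 + 1 = m then 1 else 0 := by
    intro w hw
    obtain ⟨σ, hσ⟩ := exists_perm_getElem (w := w) (w' := w₀)
      (by rw [mem_words_iff] at hw hw₀; exact Multiset.coe_eq_coe.1 (hw.trans hw₀.symm)) N
      (length_of_mem_words hw)
    refine Finset.sum_nbij' (fun A => A.map σ.toEmbedding) (fun A => A.map σ.symm.toEmbedding)
      ?_ ?_ ?_ ?_ ?_
    · intro A hA; simpa [Finset.mem_powersetCard] using hA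
    · intro A hA; simpa [Finset.mem_powersetCard] using hA
    · intro A hA; ext; simp
    · intro A hA; ext; simp
    · intro A hA
      simp only [Finset.sum_map, Equiv.toEmbedding_apply, hσ]
  calc _ = ∑ A ∈ (Finset.univ : Finset (Fin N)).powersetCard m,
        ∑ w ∈ words s, if ∑ j ∈ A, w.getD j 0 + 1 = m then 1 else 0 := by
        rw [Finset.sum_congr rfl h1]; simp
    _ = ∑ w ∈ words s, ∑ A ∈ (Finset.univ : Finset (Fin N)).powersetCard m,
        if ∑ j ∈ A, w.getD j 0 + 1 = m then 1 else 0 := Finset.sum_comm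
    _ = _ := by
        rw [Finset.sum_congr rfl h2]; simp

end PlaneTree

open PlaneTree

lemma mem_treesWith_iff (n : ℕ →₀ ℕ) (T : PlaneTree) :
    T ∈ treesWith n ↔ T.word ∈ words (Finsupp.toMultiset n) := by
  rw [mem_words_iff, treesWith, Set.mem_ofPred_eq, degStat]
  constructor
  · rintro rfl
    exact (Multiset.toFinsupp_toMultiset _).symm
  · intro h
    change Multiset.toFinsupp (T.word : Multiset ℕ) = n
    rw [h, Finsupp.toMultiset_toFinsupp]

lemma card_toMultiset_eq_nsize (n : ℕ →₀ ℕ) : (Finsupp.toMultiset n).card = nsize n := by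
  rw [Finsupp.card_toMultiset]; rfl

lemma IsDegStat.sum_toMultiset {n : ℕ →₀ ℕ} (hn : IsDegStat n) :
    (Finsupp.toMultiset n).sum + 1 = (Finsupp.toMultiset n).card := by
  rw [card_toMultiset_eq_nsize, Finsupp.sum_toMultiset, add_comm, nsize, hn]
  simp [mul_comm]

/-- The trees with degree statistic `n`, as a finite set. -/
noncomputable def treeFinset (n : ℕ →₀ ℕ) : Finset PlaneTree :=
  (words (Finsupp.toMultiset n)).preimage word word_injective.injOn

lemma coe_treeFinset (n : ℕ →₀ ℕ) : (treeFinset n : Set PlaneTree) = treesWith n := by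
  ext T
  simp [treeFinset, mem_treesWith_iff]

lemma numTrees_eq_card (n : ℕ →₀ ℕ) : numTrees n = (treeFinset n).card := by
  rw [numTrees, ← coe_treeFinset, Set.ncard_coe_finset]

lemma sum_treeFinset (n : ℕ →₀ ℕ) (F : List ℕ → ℕ) :
    ∑ T ∈ treeFinset n, F T.word =
      ∑ w ∈ words (Finsupp.toMultiset n) with IsTreeWord w, F w := by
  rw [treeFinset, Finset.sum_preimage' word _ word_injective.injOn F]
  rfl

lemma expect_eq_sum_div (n : ℕ →₀ ℕ) (f : PlaneTree → ℕ) :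
    expect n f = ((∑ T ∈ treeFinset n, f T : ℕ) : ℝ) / (treeFinset n).card := by
  have hprob : ∀ k, prob n (fun T => f T = k) =
      (((treeFinset n).filter fun T => f T = k).card : ℝ) / (treeFinset n).card := by
    intro k
    rw [prob, numTrees_eq_card]
    congr 2
    rw [← Set.ncard_coe_finset, Finset.coe_filter]
    congr 1
    ext T
    rw [Set.mem_ofPred_eq, Set.mem_ofPred_eq, ← coe_treeFinset, Finset.mem_coe]
  rw [expect, tsum_eq_sum (s := (treeFinset n).image f)]
  · simp_rw [hprob, ← mul_div_assoc]
    rw [← Finset.sum_div]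
    congr 1
    rw [Finset.sum_comp (fun k => k) f]
    push_cast
    refine Finset.sum_congr rfl fun k _ => ?_
    rw [smul_eq_mul, mul_comm]
    push_cast
    rfl
  · intro k hk
    rw [hprob, Finset.filter_eq_empty_iff.2]
    · simp
    · intro T hT h
      exact hk (Finset.mem_image.2 ⟨T, hT, h⟩)

/-- The probability that `m` samples without replacement from the values of `d` have sum
`m - 1`. -/
noncomputable def sampleProb {N : ℕ} (d : Fin N → ℕ) (m : ℕ) : ℝ :=
  (((Finset.univ : Finset (Fin N)).powersetCard m |>.filter
    fun A : Finset (Fin N) => ∑ j ∈ A, d j + 1 = m).card : ℝ) / N.choose m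

/-- An enumeration of the degrees given by a degree statistic. -/
noncomputable def degreeSeq (n : ℕ →₀ ℕ) (j : Fin (Finsupp.toMultiset n).card) : ℕ :=
  (Finsupp.toMultiset n).toList.getD j 0

lemma sum_degreeSeq {M : Type*} [AddCommMonoid M] (n : ℕ →₀ ℕ) (f : ℕ → M) :
    ∑ j, f (degreeSeq n j) = n.sum fun i c => c • f i := by
  have h1 : ∑ j, f (degreeSeq n j) = ((Finsupp.toMultiset n).map f).sum := by
    conv_rhs => rw [← Multiset.coe_toList (Finsupp.toMultiset n),
      ← ofFn_getD _ _ (Multiset.length_toList (Finsupp.toMultiset n))]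
    rw [Multiset.map_coe, Multiset.sum_coe, List.map_ofFn, List.sum_ofFn]
    rfl
  rw [h1, Finset.sum_multiset_map_count, Finsupp.toFinset_toMultiset]
  simp only [Finsupp.count_toMultiset]
  rfl

/-- The expected number of fringe trees of size `m` in terms of sampling without replacement. -/
lemma expect_countSize_eq (n : ℕ →₀ ℕ) (hn : IsDegStat n) (m : ℕ) (hm1 : 1 ≤ m)
    (hm : m ≤ nsize n) :
    expect n (countSize m) = (nsize n : ℝ) / m * sampleProb (degreeSeq n) m := by
  set s := Finsupp.toMultiset n with hs
  have hcard : s.card = nsize n := card_toMultiset_eq_nsize n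
  have hsum : s.sum + 1 = s.card := hn.sum_toMultiset
  have h1 : ∑ T ∈ treeFinset n, countSize m T =
      ∑ w ∈ words s, if IsTreeWord (w.take m) then 1 else 0 := by
    rw [← sum_isTreeWord_sum_rotate s hsum (fun w => if IsTreeWord (w.take m) then 1 else 0),
      ← sum_treeFinset]
    refine Finset.sum_congr rfl fun T hT => ?_
    have hT : T.word ∈ words s := by simpa [treeFinset] using hT
    have hsize : T.size = s.card := by rw [← length_word, length_of_mem_words hT]
    rw [countSize_eq_sum T m (by omega), hsize]
  have h2 : s.card * (treeFinset n).card = (words s).card := by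
    have := sum_isTreeWord_sum_rotate s hsum (fun _ => 1)
    rw [← sum_treeFinset n (fun w => ∑ i ∈ Finset.range s.card, 1)] at this
    simpa [mul_comm] using this
  have h3 := sum_isTreeWord_take s m (by omega)
  have h4 := choose_mul_sum_take s m (by omega) s.toList (by rw [mem_words_iff, Multiset.coe_toList])
  have hw : 0 < (words s).card :=
    Finset.card_pos.2 ⟨s.toList, by rw [mem_words_iff, Multiset.coe_toList]⟩
  have hch : 0 < s.card.choose m := Nat.choose_pos (by omega)
  rw [expect_eq_sum_div, sampleProb, h1]
  rw [← h3, ← h2] at h4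
  have ht : 0 < (treeFinset n).card := by
    rw [← h2] at hw; exact pos_of_mul_pos_right hw (Nat.zero_le _)
  rw [← hcard]
  have h4' := congrArg (Nat.cast : ℕ → ℝ) h4
  rw [div_mul_div_comm, div_eq_div_iff (by positivity) (by positivity)]
  simp only [degreeSeq, ← hs]
  push_cast at h4' ⊢
  linarith

lemma integral_cexp_int_mul_div (k : ℤ) {L : ℝ} (hL : 0 < L) :
    ∫ u in Set.Ioc (-(Real.pi * L)) (Real.pi * L), Complex.exp (Complex.I * k * ((u / L : ℝ) : ℂ)) =
      if k = 0 then ((2 * Real.pi * L : ℝ) : ℂ) else 0 := by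
  have hpi := Real.pi_pos
  rw [← intervalIntegral.integral_of_le (by nlinarith [mul_pos hpi hL])]
  split_ifs with hk
  · subst hk
    simp only [Int.cast_zero, mul_zero, zero_mul, Complex.exp_zero,
      intervalIntegral.integral_const]
    rw [Complex.real_smul, mul_one]
    congr 1; ring
  · have hL' : (L : ℂ) ≠ 0 := by exact_mod_cast hL.ne'
    have hk' : (k : ℂ) ≠ 0 := by exact_mod_cast hk
    have hc : Complex.I * k / L ≠ 0 := div_ne_zero (mul_ne_zero Complex.I_ne_zero hk') hL'
    have : ∀ u : ℝ, Complex.exp (Complex.I * k * ((u / L : ℝ) : ℂ)) =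
        Complex.exp (Complex.I * k / L * u) := by
      intro u; congr 1; push_cast; ring
    simp_rw [this]
    rw [integral_exp_mul_complex hc, div_eq_zero_iff]
    left
    rw [sub_eq_zero, Complex.exp_eq_exp_iff_exists_int]
    refine ⟨k, ?_⟩
    push_cast
    field_simp
    ring

/-- The characteristic function of the number and the sum of the Bernoulli samples of the values
`d - 1`, twisted by the character of the values `m` and `-1`. -/
noncomputable def bernoulliChar {N : ℕ} (d : Fin N → ℕ) (m : ℕ) (θ u t : ℝ) : ℂ :=
  Complex.exp (-Complex.I * (u * m - t)) *
    ∏ j, (1 - θ + θ * Complex.exp (Complex.I * (u + t * (d j - 1))))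

lemma continuous_bernoulliChar {N : ℕ} (d : Fin N → ℕ) (m : ℕ) (θ : ℝ) :
    Continuous fun z : ℝ × ℝ => bernoulliChar d m θ z.1 z.2 := by
  unfold bernoulliChar
  fun_prop

lemma bernoulliChar_eq_sum {N : ℕ} (d : Fin N → ℕ) (m : ℕ) (θ u t : ℝ) :
    bernoulliChar d m θ u t = ∑ A : Finset (Fin N), ((θ : ℂ) ^ A.card * (1 - θ) ^ (N - A.card)) *
      (Complex.exp (Complex.I * ((A.card - m : ℤ) : ℂ) * u) *
        Complex.exp (Complex.I * ((∑ j ∈ A, d j - A.card + 1 : ℤ) : ℂ) * t)) := by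
  have h1 : ∀ j, (1 - θ + θ * Complex.exp (Complex.I * (u + t * (d j - 1))) : ℂ) =
      θ * Complex.exp (Complex.I * (u + t * (d j - 1))) + (1 - θ) := fun j => add_comm _ _
  rw [bernoulliChar, Finset.prod_congr rfl fun j _ => h1 j, Finset.prod_add, Finset.powerset_univ,
    Finset.mul_sum]
  refine Finset.sum_congr rfl fun A _ => ?_
  rw [Finset.prod_mul_distrib, Finset.prod_const, Finset.prod_const, ← Finset.compl_eq_univ_sdiff,
    Finset.card_compl, Fintype.card_fin, ← Complex.exp_sum, ← Complex.exp_add]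
  have h2 : ∀ a b c e : ℂ, a * (b * c * e) = (b * e) * (a * c) := fun a b c e => by ring
  rw [h2, ← Complex.exp_add]
  congr 2
  rw [← Finset.mul_sum, Finset.sum_add_distrib, ← Finset.mul_sum, Finset.sum_sub_distrib]
  simp only [Finset.sum_const, nsmul_eq_mul, mul_one]
  push_cast
  ring

/-- Fourier inversion for the number of `m`-subsets with sum `m - 1`. -/
lemma integral_bernoulliChar {N : ℕ} (d : Fin N → ℕ) (m : ℕ) (θ : ℝ) {L : ℝ} (hL : 0 < L) :
    ∫ z in Set.Ioc (-(Real.pi * L)) (Real.pi * L) ×ˢ Set.Ioc (-(Real.pi * L)) (Real.pi * L),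
        bernoulliChar d m θ (z.1 / L) (z.2 / L) =
      (((2 * Real.pi * L) ^ 2 * (θ ^ m * (1 - θ) ^ (N - m)) *
        ((Finset.univ : Finset (Fin N)).powersetCard m |>.filter
          fun A : Finset (Fin N) => ∑ j ∈ A, d j + 1 = m).card : ℝ) : ℂ) := by
  set S := Set.Ioc (-(Real.pi * L)) (Real.pi * L) with hS
  have hint : ∀ k : ℤ, IntegrableOn
      (fun u : ℝ => Complex.exp (Complex.I * k * ((u / L : ℝ) : ℂ))) S := by
    intro k
    refine ((Continuous.continuousOn (by fun_prop)).integrableOn_Icc).mono_set Set.Ioc_subset_Icc_self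
  simp_rw [bernoulliChar_eq_sum]
  rw [integral_finsetSum]
  · have h : ∀ A : Finset (Fin N), ∫ z in S ×ˢ S,
        ((θ : ℂ) ^ A.card * (1 - θ) ^ (N - A.card)) *
        (Complex.exp (Complex.I * ((A.card - m : ℤ) : ℂ) * ((z.1 / L : ℝ) : ℂ)) *
          Complex.exp (Complex.I * ((∑ j ∈ A, d j - A.card + 1 : ℤ) : ℂ) * ((z.2 / L : ℝ) : ℂ))) =
        if A.card = m ∧ ∑ j ∈ A, d j + 1 = m then
          (((2 * Real.pi * L) ^ 2 * (θ ^ m * (1 - θ) ^ (N - m)) : ℝ) : ℂ) else 0 := by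
      intro A
      rw [integral_const_mul]
      have := setIntegral_prod_mul (μ := volume) (ν := volume)
        (fun u : ℝ => Complex.exp (Complex.I * ((A.card - m : ℤ) : ℂ) * ((u / L : ℝ) : ℂ)))
        (fun t : ℝ => Complex.exp (Complex.I * ((∑ j ∈ A, d j - A.card + 1 : ℤ) : ℂ) *
          ((t / L : ℝ) : ℂ))) S S
      rw [Measure.volume_eq_prod, this, integral_cexp_int_mul_div _ hL,
        integral_cexp_int_mul_div _ hL]
      have e1 : (A.card - m : ℤ) = 0 ↔ A.card = m := by omega
      by_cases h1 : A.card = m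
      · have e2 : (∑ j ∈ A, d j - A.card + 1 : ℤ) = 0 ↔ ∑ j ∈ A, d j + 1 = m := by omega
        by_cases h2 : ∑ j ∈ A, d j + 1 = m
        · rw [if_pos (e1.2 h1), if_pos (e2.2 h2), if_pos ⟨h1, h2⟩, h1]
          push_cast
          ring
        · rw [if_pos (e1.2 h1), if_neg (mt e2.1 h2), if_neg fun h => h2 h.2]
          simp
      · rw [if_neg (mt e1.1 h1)]
        simp [h1]
    rw [Finset.sum_congr rfl fun A _ => h A, ← Finset.sum_filter, Finset.sum_const, nsmul_eq_mul]
    have hfin : (Finset.univ.filter fun A : Finset (Fin N) =>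
        A.card = m ∧ ∑ j ∈ A, d j + 1 = m) =
        ((Finset.univ : Finset (Fin N)).powersetCard m |>.filter
          fun A : Finset (Fin N) => ∑ j ∈ A, d j + 1 = m) := by
      ext A
      simp [Finset.mem_powersetCard]
    rw [hfin]
    push_cast
    ring
  · intro A _
    refine Integrable.const_mul ?_ _
    rw [Measure.volume_eq_prod, ← Measure.prod_restrict]
    exact (hint _).mul_prod (hint _)

lemma norm_one_sub_add_mul_cexp_le (θ a : ℝ) :
    ‖(1 - θ + θ * Complex.exp (Complex.I * a) : ℂ)‖ ≤
      Real.exp (-(θ * (1 - θ) * (1 - Real.cos a))) := by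
  refine le_of_sq_le_sq ?_ (Real.exp_pos _).le
  rw [← Real.exp_nat_mul, ← Complex.normSq_eq_norm_sq, mul_comm Complex.I, Complex.exp_mul_I,
    ← Complex.ofReal_cos, ← Complex.ofReal_sin, Complex.normSq_apply]
  simp only [Complex.add_re, Complex.sub_re, Complex.one_re, Complex.ofReal_re, Complex.mul_re,
    Complex.ofReal_im, Complex.I_re, Complex.I_im, Complex.add_im, Complex.sub_im, Complex.one_im,
    Complex.mul_im]
  have h2 := Real.add_one_le_exp (((2 : ℕ) : ℝ) * -(θ * (1 - θ) * (1 - Real.cos a)))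
  refine le_trans (le_of_eq ?_) h2
  push_cast
  linear_combination θ ^ 2 * Real.sin_sq_add_cos_sq a

lemma norm_bernoulliChar_le {N : ℕ} (d : Fin N → ℕ) (m : ℕ) (θ u t : ℝ) : ‖bernoulliChar d m θ u t‖ ≤
      Real.exp (-(θ * (1 - θ) * ∑ j, (1 - Real.cos (u + t * (d j - 1))))) := by
  have h2 : ‖Complex.exp (-Complex.I * (u * m - t))‖ = 1 := by
    have : -Complex.I * (u * m - t) = ((-(u * m - t) : ℝ) : ℂ) * Complex.I := by push_cast; ring
    rw [this, Complex.norm_exp_ofReal_mul_I]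
  rw [bernoulliChar, norm_mul, h2, one_mul, norm_prod, Finset.mul_sum, ← Finset.sum_neg_distrib,
    Real.exp_sum]
  refine Finset.prod_le_prod (fun _ _ => norm_nonneg _) fun j _ => ?_
  have := norm_one_sub_add_mul_cexp_le θ (u + t * (d j - 1))
  push_cast at this ⊢
  exact this

lemma norm_cexp_I_sub_taylor_le (y : ℝ) :
    ‖Complex.exp (Complex.I * y) - (1 + Complex.I * y - y ^ 2 / 2)‖ ≤ 4 * (y ^ 2 * min 1 |y|) := by
  have hI : ‖Complex.I * (y : ℂ)‖ = |y| := by simp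
  rcases le_or_gt |y| 1 with h | h
  · have h1 := Complex.exp_bound (x := Complex.I * y) (by rw [hI]; exact h) (n := 3) (by norm_num)
    rw [hI] at h1
    rw [min_eq_right h]
    have h2 : ∑ i ∈ Finset.range 3, (Complex.I * (y : ℂ)) ^ i / (i.factorial : ℂ) =
        1 + Complex.I * y - y ^ 2 / 2 := by
      simp only [Finset.sum_range_succ, Finset.sum_range_zero, Nat.factorial]
      push_cast
      linear_combination (y : ℂ) ^ 2 / 2 * Complex.I_sq
    rw [h2] at h1
    refine h1.trans ?_
    norm_num [Nat.factorial]
    have : |y| ^ 3 = y ^ 2 * |y| := by rw [← sq_abs y]; ring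
    rw [this]
    nlinarith [mul_nonneg (sq_nonneg y) (abs_nonneg y)]
  · rw [min_eq_left h.le, mul_one]
    have h1 : ‖Complex.exp (Complex.I * y)‖ = 1 := by
      rw [mul_comm, Complex.norm_exp_ofReal_mul_I]
    have h3 : ‖((y : ℂ) ^ 2 / 2)‖ = y ^ 2 / 2 := by
      simp
    have h2 : ‖Complex.exp (Complex.I * y) - (1 + Complex.I * y - y ^ 2 / 2)‖ ≤
        1 + (1 + |y| + y ^ 2 / 2) := by
      refine (norm_sub_le _ _).trans ?_
      rw [h1]
      gcongr
      refine (norm_sub_le _ _).trans ?_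
      rw [h3]
      gcongr
      refine (norm_add_le _ _).trans ?_
      rw [hI, norm_one]
    refine h2.trans ?_
    nlinarith [sq_abs y]

lemma abs_exp_neg_sub_le {b : ℝ} (hb : 0 ≤ b) : |Real.exp (-b) - (1 - b)| ≤ b * min 1 b := by
  have h1 := Real.add_one_le_exp (-b)
  rw [abs_of_nonneg (by linarith)]
  rcases le_or_gt b 1 with h | h
  · rw [min_eq_right h]
    have := Real.abs_exp_sub_one_sub_id_le (x := -b) (by rw [abs_neg, abs_of_nonneg hb]; exact h)
    have := (abs_le.1 this).2
    nlinarith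
  · rw [min_eq_left h.le]
    have : Real.exp (-b) ≤ 1 := Real.exp_le_one_iff.2 (by linarith)
    linarith

lemma norm_cexp_mul_sub_gaussian_le {θ : ℝ} (h0 : 0 ≤ θ) (h1 : θ ≤ 1) (a : ℝ) :
    ‖Complex.exp (-Complex.I * (θ * a)) * (1 - θ + θ * Complex.exp (Complex.I * a)) -
      Complex.exp (-(θ * (1 - θ) * a ^ 2 / 2))‖ ≤ 5 * (θ * (1 - θ) * a ^ 2 * min 1 |a|) := by
  have hθ : 0 ≤ θ * (1 - θ) := mul_nonneg h0 (by linarith)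
  set R : ℝ → ℂ := fun y => Complex.exp (Complex.I * y) - (1 + Complex.I * y - y ^ 2 / 2) with hR
  set b : ℝ := θ * (1 - θ) * a ^ 2 / 2 with hb
  have hb0 : 0 ≤ b := by positivity
  have e1 : Complex.exp (-Complex.I * (θ * a)) * (1 - θ + θ * Complex.exp (Complex.I * a)) -
      Complex.exp (-(θ * (1 - θ) * a ^ 2 / 2)) = (1 - θ : ℝ) * R (-(θ * a)) + θ * R ((1 - θ) * a) -
        ((Real.exp (-b) - (1 - b) : ℝ) : ℂ) := by
    have e2 : Complex.exp (-Complex.I * (θ * a)) * Complex.exp (Complex.I * a) =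
        Complex.exp (Complex.I * ((1 - θ) * a)) := by
      rw [← Complex.exp_add]; congr 1; ring
    have e3 : Complex.exp (-Complex.I * (θ * a)) = Complex.exp (Complex.I * (-(θ * a))) := by
      congr 1; ring
    simp only [hR, hb]
    push_cast
    rw [← e2, ← e3]
    ring
  have hmin : ∀ c : ℝ, 0 ≤ c → c ≤ 1 → min 1 |c * a| ≤ min 1 |a| := by
    intro c hc hc'
    rw [abs_mul, abs_of_nonneg hc]
    exact min_le_min_left _ (mul_le_of_le_one_left (abs_nonneg a) hc')
  have hr1 : ‖((1 - θ : ℝ) : ℂ) * R (-(θ * a))‖ ≤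
      (1 - θ) * (4 * ((θ * a) ^ 2 * min 1 |a|)) := by
    rw [norm_mul, Complex.norm_real, Real.norm_of_nonneg (by linarith)]
    refine mul_le_mul_of_nonneg_left ?_ (by linarith)
    have := norm_cexp_I_sub_taylor_le (-(θ * a))
    rw [abs_neg, neg_sq] at this
    refine this.trans ?_
    exact mul_le_mul_of_nonneg_left
      (mul_le_mul_of_nonneg_left (hmin θ h0 h1) (sq_nonneg _)) zero_le_four
  have hr2 : ‖(θ : ℂ) * R ((1 - θ) * a)‖ ≤ θ * (4 * (((1 - θ) * a) ^ 2 * min 1 |a|)) := by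
    rw [norm_mul, Complex.norm_real, Real.norm_of_nonneg h0]
    refine mul_le_mul_of_nonneg_left ?_ h0
    refine (norm_cexp_I_sub_taylor_le ((1 - θ) * a)).trans ?_
    exact mul_le_mul_of_nonneg_left (mul_le_mul_of_nonneg_left
      (hmin (1 - θ) (by linarith) (by linarith)) (sq_nonneg _)) zero_le_four
  have hr3 : ‖((Real.exp (-b) - (1 - b) : ℝ) : ℂ)‖ ≤ θ * (1 - θ) * a ^ 2 * min 1 |a| := by
    rw [Complex.norm_real, Real.norm_eq_abs]
    refine (abs_exp_neg_sub_le hb0).trans ?_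
    have hb1 : b ≤ θ * (1 - θ) * a ^ 2 := by rw [hb]; nlinarith [mul_nonneg hθ (sq_nonneg a)]
    refine mul_le_mul hb1 ?_ (by positivity) (by positivity)
    refine le_min (min_le_left _ _) ?_
    rcases le_or_gt |a| 1 with h | h
    · refine (min_le_right _ _).trans ?_
      have : a ^ 2 ≤ |a| := by rw [← sq_abs]; nlinarith [abs_nonneg a]
      have : θ * (1 - θ) ≤ 1 := by nlinarith
      nlinarith [sq_nonneg a]
    · exact (min_le_left _ _).trans h.le
  rw [e1]
  refine (norm_sub_le _ _).trans ?_
  have := norm_add_le (((1 - θ : ℝ) : ℂ) * R (-(θ * a))) ((θ : ℂ) * R ((1 - θ) * a))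
  have e4 : (1 - θ) * (4 * ((θ * a) ^ 2 * min 1 |a|)) + θ * (4 * (((1 - θ) * a) ^ 2 * min 1 |a|)) =
      4 * (θ * (1 - θ) * a ^ 2 * min 1 |a|) := by ring
  linarith

lemma norm_prod_sub_prod_le {ι : Type*} (s : Finset ι) (z w : ι → ℂ) (hz : ∀ i, ‖z i‖ ≤ 1)
    (hw : ∀ i, ‖w i‖ ≤ 1) : ‖∏ i ∈ s, z i - ∏ i ∈ s, w i‖ ≤ ∑ i ∈ s, ‖z i - w i‖ := by
  induction s using Finset.induction_on with
  | empty => simp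
  | insert i s hi ih =>
    rw [Finset.prod_insert hi, Finset.prod_insert hi, Finset.sum_insert hi]
    have h1 : z i * ∏ i ∈ s, z i - w i * ∏ i ∈ s, w i =
        (z i - w i) * ∏ i ∈ s, z i + w i * (∏ i ∈ s, z i - ∏ i ∈ s, w i) := by ring
    rw [h1]
    refine (norm_add_le _ _).trans (add_le_add ?_ ?_)
    · rw [norm_mul, norm_prod]
      exact mul_le_of_le_one_right (norm_nonneg _)
        (Finset.prod_le_one (fun _ _ => norm_nonneg _) fun i _ => hz i)
    · rw [norm_mul]
      exact (mul_le_of_le_one_left (norm_nonneg _) (hw i)).trans ih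

/-- Gaussian approximation of `bernoulliChar`. -/
lemma norm_bernoulliChar_sub_le {N : ℕ} (d : Fin N → ℕ) (hd : ∑ j, d j + 1 = N) {m : ℕ} (hN : 0 < N)
    (hm : m ≤ N) (u t : ℝ) :
    ‖bernoulliChar d m (m / N : ℝ) u t - Complex.exp (Complex.I * (t * (1 - (m / N : ℝ)) : ℝ)) *
      (Real.exp (-((m / N) * (1 - m / N) * ∑ j, (u + t * (d j - 1)) ^ 2 / 2)) : ℝ)‖ ≤
      5 * (m / N * (1 - m / N) *
        ∑ j, (u + t * (d j - 1)) ^ 2 * min 1 |u + t * (d j - 1)| : ℝ) := by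
  have hN' : (0 : ℝ) < N := by exact_mod_cast hN
  set θ : ℝ := m / N with hθ
  have h0 : 0 ≤ θ := by positivity
  have h1 : θ ≤ 1 := by rw [hθ, div_le_one hN']; exact_mod_cast hm
  have hθN : θ * N = m := by rw [hθ]; field_simp
  set a : Fin N → ℝ := fun j => u + t * (d j - 1) with ha
  have hsum : ∑ j, a j = N * u - t := by
    have : (∑ j, (d j : ℝ)) + 1 = N := by exact_mod_cast hd
    simp only [ha, Finset.sum_add_distrib, ← Finset.mul_sum, Finset.sum_sub_distrib]
    simp only [Finset.sum_const, Finset.card_univ, Fintype.card_fin, nsmul_eq_mul]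
    linear_combination t * this
  set z : Fin N → ℂ := fun j =>
    Complex.exp (-Complex.I * (θ * a j)) * (1 - θ + θ * Complex.exp (Complex.I * a j)) with hz
  set w : Fin N → ℂ := fun j => Complex.exp (-(θ * (1 - θ) * a j ^ 2 / 2)) with hw
  have e1 : bernoulliChar d m θ u t = Complex.exp (Complex.I * (t * (1 - θ) : ℝ)) * ∏ j, z j := by
    simp only [hz]
    rw [Finset.prod_mul_distrib, ← Complex.exp_sum, ← mul_assoc, ← Complex.exp_add, bernoulliChar]
    congr 1
    · congr 1
      rw [← Finset.mul_sum, ← Finset.mul_sum, ← Complex.ofReal_sum, hsum]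
      push_cast
      have : (θ : ℂ) * N = m := by exact_mod_cast hθN
      linear_combination (Complex.I * u) * this
    · refine Finset.prod_congr rfl fun j _ => ?_
      simp only [ha]
      push_cast
      rfl
  have e2 : ((Real.exp (-(θ * (1 - θ) * ∑ j, a j ^ 2 / 2)) : ℝ) : ℂ) = ∏ j, w j := by
    simp only [hw]
    rw [← Complex.exp_sum]
    push_cast
    congr 1
    rw [Finset.sum_neg_distrib, Finset.mul_sum]
    congr 1
    exact Finset.sum_congr rfl fun j _ => by ring
  rw [e1, e2, ← mul_sub, norm_mul, mul_comm Complex.I, Complex.norm_exp_ofReal_mul_I, one_mul]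
  refine (norm_prod_sub_prod_le _ z w ?_ ?_).trans ?_
  · intro j
    simp only [hz]
    have e3 : -Complex.I * ((θ : ℂ) * a j) = ((-(θ * a j) : ℝ) : ℂ) * Complex.I := by
      push_cast; ring
    rw [norm_mul, e3, Complex.norm_exp_ofReal_mul_I, one_mul]
    refine (norm_one_sub_add_mul_cexp_le θ _).trans (Real.exp_le_one_iff.2 ?_)
    rw [neg_nonpos]
    exact mul_nonneg (mul_nonneg h0 (by linarith)) (by linarith [Real.cos_le_one (a j)])
  · intro j
    simp only [hw]
    have e3 : -((θ : ℂ) * (1 - θ) * a j ^ 2 / 2) = ((-(θ * (1 - θ) * a j ^ 2 / 2) : ℝ) : ℂ) := by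
      push_cast; ring
    rw [e3, Complex.norm_exp_ofReal]
    refine Real.exp_le_one_iff.2 (neg_nonpos.2 ?_)
    have : 0 ≤ 1 - θ := by linarith
    positivity
  · rw [Finset.mul_sum, Finset.mul_sum]
    refine Finset.sum_le_sum fun j _ => ?_
    have := norm_cexp_mul_sub_gaussian_le h0 h1 (a j)
    rw [← mul_assoc (θ * (1 - θ))]
    exact this

/-- Generalized dominated convergence: weights converging pointwise and in total mass. -/
lemma tendsto_tsum_mul_of_tendsto {W h : ℕ → ℕ → ℝ} {w g : ℕ → ℝ} {C : ℝ}
    (hW0 : ∀ κ i, 0 ≤ W κ i) (hWs : ∀ κ, Summable (W κ)) (hws : Summable w)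
    (hW : ∀ i, Tendsto (fun κ => W κ i) atTop (𝓝 (w i)))
    (hWsum : Tendsto (fun κ => ∑' i, W κ i) atTop (𝓝 (∑' i, w i)))
    (hC : ∀ κ i, |h κ i| ≤ C) (hh : ∀ i, Tendsto (fun κ => h κ i) atTop (𝓝 (g i))) :
    Tendsto (fun κ => ∑' i, W κ i * h κ i) atTop (𝓝 (∑' i, w i * g i)) := by
  have hw0 : ∀ i, 0 ≤ w i := fun i => ge_of_tendsto' (hW i) fun κ => hW0 κ i
  have hpos : ∀ κ i, |max (w i - W κ i) 0| ≤ w i := fun κ i => by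
    rw [abs_of_nonneg (le_max_right _ _)]
    exact max_le (by linarith [hW0 κ i]) (hw0 i)
  have hposs : ∀ κ, Summable fun i => max (w i - W κ i) 0 := fun κ =>
    Summable.of_norm_bounded hws (hpos κ)
  have h1 : Tendsto (fun κ => ∑' i, max (w i - W κ i) 0) atTop (𝓝 0) := by
    have := tendsto_tsum_of_dominated_convergence (𝓕 := atTop) (f := fun κ i => max (w i - W κ i) 0)
      (g := fun _ => (0 : ℝ)) (bound := w) hws
      (fun i => by simpa using ((hW i).const_sub (w i)).max (tendsto_const_nhds (x := (0 : ℝ))))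
      (Eventually.of_forall fun κ i => hpos κ i)
    simpa using this
  have h2 : Tendsto (fun κ => ∑' i, |W κ i - w i|) atTop (𝓝 0) := by
    have e : ∀ κ, ∑' i, |W κ i - w i| =
        (∑' i, W κ i - ∑' i, w i) + 2 * ∑' i, max (w i - W κ i) 0 := by
      intro κ
      rw [← (hWs κ).tsum_sub hws, ← tsum_mul_left,
        ← ((hWs κ).sub hws).tsum_add ((hposs κ).mul_left 2)]
      refine tsum_congr fun i => ?_
      rcases le_total (w i) (W κ i) with h | h
      · rw [abs_of_nonneg (by linarith), max_eq_right (by linarith)]; ring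
      · rw [abs_of_nonpos (by linarith), max_eq_left (by linarith)]; ring
    simp_rw [e]
    simpa using (hWsum.sub_const (∑' i, w i)).add (h1.const_mul 2)
  have hsub : ∀ κ, Summable fun i => |W κ i - w i| := fun κ => ((hWs κ).sub hws).abs
  have hbd : ∀ κ i, ‖(W κ i - w i) * h κ i‖ ≤ C * |W κ i - w i| := fun κ i => by
    rw [Real.norm_eq_abs, abs_mul, mul_comm]
    exact mul_le_mul_of_nonneg_right (hC κ i) (abs_nonneg _)
  have h3 : Tendsto (fun κ => ∑' i, (W κ i - w i) * h κ i) atTop (𝓝 0) := by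
    refine squeeze_zero_norm (a := fun κ => C * ∑' i, |W κ i - w i|) (fun κ => ?_)
      (by simpa using h2.const_mul C)
    rw [← tsum_mul_left]
    exact tsum_of_norm_bounded ((hsub κ).mul_left C).hasSum (hbd κ)
  have hbd2 : ∀ κ i, ‖w i * h κ i‖ ≤ C * w i := fun κ i => by
    rw [Real.norm_eq_abs, abs_mul, abs_of_nonneg (hw0 i), mul_comm]
    exact mul_le_mul_of_nonneg_right (hC κ i) (hw0 i)
  have h4 : Tendsto (fun κ => ∑' i, w i * h κ i) atTop (𝓝 (∑' i, w i * g i)) :=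
    tendsto_tsum_of_dominated_convergence (hws.mul_left C) (fun i => (hh i).const_mul (w i))
      (Eventually.of_forall hbd2)
  have e : ∀ κ, ∑' i, W κ i * h κ i = ∑' i, (W κ i - w i) * h κ i + ∑' i, w i * h κ i := by
    intro κ
    rw [← (Summable.of_norm_bounded ((hsub κ).mul_left C) (hbd κ)).tsum_add
      (Summable.of_norm_bounded (hws.mul_left C) (hbd2 κ))]
    exact tsum_congr fun i => by ring
  simp_rw [e]
  simpa using h3.add h4

lemma IsDegStat.nsize_pos {n : ℕ →₀ ℕ} (hn : IsDegStat n) : 0 < nsize n := by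
  have : nsize n = _ := hn
  omega

lemma empDist_nonneg (n : ℕ →₀ ℕ) (i : ℕ) : 0 ≤ empDist n i := by
  unfold empDist; positivity

lemma empDist_eq_zero {n : ℕ →₀ ℕ} {i : ℕ} (hi : i ∉ n.support) : empDist n i = 0 := by
  rw [empDist, Finsupp.notMem_support_iff.1 hi, Nat.cast_zero, zero_div]

lemma summable_empDist_mul (n : ℕ →₀ ℕ) (f : ℕ → ℝ) : Summable fun i => empDist n i * f i :=
  summable_of_ne_finset_zero (s := n.support) fun i hi => by rw [empDist_eq_zero hi, zero_mul]

lemma sum_degreeSeq_eq_tsum {n : ℕ →₀ ℕ} (hn : 0 < nsize n) (f : ℕ → ℝ) :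
    ∑ j, f (degreeSeq n j) = nsize n * ∑' i, empDist n i * f i := by
  have hn' : (nsize n : ℝ) ≠ 0 := by exact_mod_cast hn.ne'
  rw [sum_degreeSeq, tsum_eq_sum (s := n.support) fun i hi => by rw [empDist_eq_zero hi, zero_mul],
    Finsupp.sum, Finset.mul_sum]
  refine Finset.sum_congr rfl fun i _ => ?_
  rw [empDist, nsmul_eq_mul]
  field_simp

lemma tsum_empDist {n : ℕ →₀ ℕ} (hn : 0 < nsize n) : ∑' i, empDist n i = 1 := by
  have h := sum_degreeSeq_eq_tsum hn fun _ => 1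
  have hn' : (nsize n : ℝ) ≠ 0 := by exact_mod_cast hn.ne'
  simp only [Finset.sum_const, Finset.card_univ, Fintype.card_fin, card_toMultiset_eq_nsize,
    nsmul_eq_mul, mul_one] at h
  field_simp at h
  linarith

/-- Averages of functions of at most quadratic growth converge. -/
lemma tendsto_tsum_empDist_mul {nseq : ℕ → (ℕ →₀ ℕ)} {p : ℕ → ℝ} (hc1 : Condition1 nseq p)
    (hc2 : Condition2 nseq p) {f : ℕ → ℕ → ℝ} {g : ℕ → ℝ} {C : ℝ}
    (hC : ∀ κ i, |f κ i| ≤ C * (1 + (i : ℝ) ^ 2))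
    (hf : ∀ i, Tendsto (fun κ => f κ i) atTop (𝓝 (g i))) :
    Tendsto (fun κ => ∑' i, empDist (nseq κ) i * f κ i) atTop (𝓝 (∑' i, p i * g i)) := by
  obtain ⟨hdeg, -, -, hp1, hp⟩ := hc1
  obtain ⟨hs, hs2⟩ := hc2
  have hi : ∀ i : ℕ, 0 < 1 + (i : ℝ) ^ 2 := fun i => by positivity
  have e1 : ∀ (q a : ℕ → ℝ) (i : ℕ),
      q i * a i = ((1 + (i : ℝ) ^ 2) * q i) * (a i / (1 + (i : ℝ) ^ 2)) := fun q a i => by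
    have := (hi i).ne'
    field_simp
  have e2 : ∀ (q : ℕ → ℝ), (fun i : ℕ => (1 + (i : ℝ) ^ 2) * q i) =
      fun i => q i + (i : ℝ) ^ 2 * q i := fun q => by ext i; ring
  have hsum1 : ∀ κ, Summable (empDist (nseq κ)) := fun κ => by
    simpa using summable_empDist_mul (nseq κ) fun _ => 1
  have hsum2 : ∀ κ, Summable fun i : ℕ => (i : ℝ) ^ 2 * empDist (nseq κ) i := fun κ => by
    simpa [mul_comm] using summable_empDist_mul (nseq κ) fun i => (i : ℝ) ^ 2
  rw [tsum_congr (e1 p g)]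
  rw [funext fun κ => tsum_congr (e1 (empDist (nseq κ)) (f κ))]
  refine tendsto_tsum_mul_of_tendsto (C := C) (fun κ i => mul_nonneg (hi i).le (empDist_nonneg _ _))
    (fun κ => ?_) ?_ (fun i => (hp i).const_mul _) ?_ (fun κ i => ?_) fun i => (hf i).div_const _
  · rw [e2]
    exact (hsum1 κ).add (hsum2 κ)
  · rw [e2]
    exact hp1.summable.add hs
  · have e3 : ∀ q : ℕ → ℝ, Summable q → Summable (fun i : ℕ => (i : ℝ) ^ 2 * q i) →
        ∑' i : ℕ, (1 + (i : ℝ) ^ 2) * q i = ∑' i, q i + ∑' i : ℕ, (i : ℝ) ^ 2 * q i :=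
      fun q h h' => by rw [← h.tsum_add h', e2]
    rw [e3 p hp1.summable hs, hp1.tsum_eq]
    simp_rw [fun κ => e3 _ (hsum1 κ) (hsum2 κ), fun κ => tsum_empDist (hdeg κ).nsize_pos]
    exact hs2.const_add 1
  · rw [abs_div, abs_of_pos (hi i), div_le_iff₀ (hi i)]
    exact hC κ i

lemma Nonlattice.exists_ne {p : ℕ → ℝ} (h : Nonlattice p) : ∃ i j, i ≠ j ∧ 0 < p i ∧ 0 < p j := by
  by_contra! hcon
  refine absurd (h 0 fun i j hi hj => ?_) zero_ne_one
  by_cases hij : i = j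
  · simp [hij]
  · exact absurd hj (hcon i j hij hi).not_gt

lemma Nonlattice.exists_cos_ne_one {p : ℕ → ℝ} (h : Nonlattice p) {u t : ℝ} (hu : |u| ≤ Real.pi)
    (ht : |t| ≤ Real.pi) (hut : ¬(u = 0 ∧ t = 0)) :
    ∃ i : ℕ, 0 < p i ∧ Real.cos (u + t * (i - 1)) ≠ 1 := by
  have hpi := Real.pi_pos
  have hzero : ∀ {x : ℝ} {k : ℤ}, |x| ≤ Real.pi → (k : ℝ) * (2 * Real.pi) = x → x = 0 := by
    intro x k hx hk
    have : |(k : ℝ)| < 1 := by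
      have h1 : |(k : ℝ)| * (2 * Real.pi) ≤ Real.pi := by
        rw [← hk, abs_mul, abs_of_pos (by linarith : 0 < 2 * Real.pi)] at hx
        exact hx
      nlinarith
    have hk0 : k = 0 := by
      have : |k| < 1 := by exact_mod_cast this
      exact Int.abs_lt_one_iff.1 this
    rw [← hk, hk0]; simp
  by_contra! hcon
  have hcon' : ∀ i : ℕ, 0 < p i → ∃ k : ℤ, (k : ℝ) * (2 * Real.pi) = u + t * (i - 1) :=
    fun i hi => (Real.cos_eq_one_iff _).1 (hcon i hi)
  let H : AddSubgroup ℤ :=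
    { carrier := {k | ∃ l : ℤ, (l : ℝ) * (2 * Real.pi) = t * k}
      zero_mem' := ⟨0, by simp⟩
      add_mem' := by
        rintro a b ⟨k, hk⟩ ⟨l, hl⟩
        exact ⟨k + l, by push_cast; linear_combination hk + hl⟩
      neg_mem' := by
        rintro a ⟨k, hk⟩
        exact ⟨-k, by push_cast; linear_combination -hk⟩ }
  obtain ⟨a, ha⟩ := Int.subgroup_cyclic H
  have h1 : a.natAbs = 1 := by
    refine h _ fun i j hi hj => ?_
    obtain ⟨k, hk⟩ := hcon' i hi
    obtain ⟨l, hl⟩ := hcon' j hj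
    have hmem : (i : ℤ) - j ∈ H := ⟨k - l, by push_cast; linear_combination hk - hl⟩
    rw [ha, AddSubgroup.mem_closure_singleton] at hmem
    obtain ⟨c, hc⟩ := hmem
    rw [Int.natAbs_dvd, ← hc]
    exact ⟨c, by simp [mul_comm]⟩
  have h2 : (1 : ℤ) ∈ H := by
    rw [ha, AddSubgroup.mem_closure_singleton]
    rcases Int.natAbs_eq a with h | h
    · exact ⟨1, by rw [h, h1]; simp⟩
    · exact ⟨-1, by rw [h, h1]; simp⟩
  obtain ⟨l, hl⟩ := h2
  have ht0 : t = 0 := hzero ht (k := l) (by simpa using hl)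
  obtain ⟨i, -, -, hi, -⟩ := h.exists_ne
  obtain ⟨k, hk⟩ := hcon' i hi
  exact hut ⟨hzero hu (k := k) (by simpa [ht0] using hk), ht0⟩

lemma exists_quadratic_lower_bound_nhds_zero {p : ℕ → ℝ} (h : Nonlattice p) :
    ∃ F : Finset ℕ, ∃ c > 0, ∀ᶠ z : ℝ × ℝ in 𝓝 (0, 0), c * (z.1 ^ 2 + z.2 ^ 2) ≤
      ∑ i ∈ F, p i * (1 - Real.cos (z.1 + z.2 * (i - 1))) := by
  obtain ⟨i, j, hij, hi, hj⟩ := h.exists_ne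
  have hpi := Real.pi_pos
  have hK : 0 < 4 + 4 * ((i : ℝ) - 1) ^ 2 := by positivity
  set e := 2 / Real.pi ^ 2 * min (p i) (p j) with he
  have he0 : 0 < e := by have := lt_min hi hj; positivity
  refine ⟨{i, j}, e / (4 + 4 * ((i : ℝ) - 1) ^ 2), by positivity, ?_⟩
  have hnear : ∀ k : ℕ, ∀ᶠ z : ℝ × ℝ in 𝓝 (0, 0), |z.1 + z.2 * (k - 1)| < Real.pi := by
    intro k
    have hc : Continuous fun z : ℝ × ℝ => |z.1 + z.2 * (k - 1)| := by fun_prop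
    exact hc.continuousAt.eventually_lt continuousAt_const (by simpa using hpi)
  filter_upwards [hnear i, hnear j] with z hzi hzj
  rw [Finset.sum_pair hij]
  have h1 := Real.cos_le_one_sub_mul_cos_sq hzi.le
  have h2 := Real.cos_le_one_sub_mul_cos_sq hzj.le
  set a := z.1 + z.2 * ((i : ℝ) - 1) with ha
  set b := z.1 + z.2 * ((j : ℝ) - 1) with hb
  have hdiff : z.2 ^ 2 ≤ 2 * (a ^ 2 + b ^ 2) := by
    have h3 : z.2 * ((i : ℝ) - j) = a - b := by rw [ha, hb]; ring
    have h4 : 1 ≤ ((i : ℝ) - j) ^ 2 := by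
      have : 1 ≤ ((i : ℤ) - j) ^ 2 := by
        have : (i : ℤ) - j ≠ 0 := by omega
        have := pow_pos (abs_pos.2 this) 2
        rw [sq_abs] at this
        omega
      exact_mod_cast this
    have h5 : z.2 ^ 2 * ((i : ℝ) - j) ^ 2 = (a - b) ^ 2 := by rw [← h3]; ring
    nlinarith [sq_nonneg (a + b), mul_nonneg (sq_nonneg z.2) (sub_nonneg.2 h4)]
  have h6 : z.1 ^ 2 + z.2 ^ 2 ≤ (4 + 4 * ((i : ℝ) - 1) ^ 2) * (a ^ 2 + b ^ 2) := by
    have : z.1 = a - z.2 * ((i : ℝ) - 1) := by rw [ha]; ring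
    have h7 : z.1 ^ 2 ≤ 2 * a ^ 2 + 2 * (z.2 ^ 2 * ((i : ℝ) - 1) ^ 2) := by
      rw [this]; nlinarith [sq_nonneg (a + z.2 * ((i : ℝ) - 1))]
    nlinarith [mul_le_mul_of_nonneg_right hdiff (sq_nonneg ((i : ℝ) - 1)), sq_nonneg a, sq_nonneg b]
  have h8 : e * (a ^ 2 + b ^ 2) ≤ p i * (1 - Real.cos a) + p j * (1 - Real.cos b) := by
    have h9 : p i * (2 / Real.pi ^ 2 * a ^ 2) ≤ p i * (1 - Real.cos a) :=
      mul_le_mul_of_nonneg_left (by linarith) hi.le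
    have h10 : p j * (2 / Real.pi ^ 2 * b ^ 2) ≤ p j * (1 - Real.cos b) :=
      mul_le_mul_of_nonneg_left (by linarith) hj.le
    have h11 : 0 ≤ 2 / Real.pi ^ 2 * a ^ 2 := by positivity
    have h12 : 0 ≤ 2 / Real.pi ^ 2 * b ^ 2 := by positivity
    have h13 := mul_le_mul_of_nonneg_right (min_le_left (p i) (p j)) h11
    have h14 := mul_le_mul_of_nonneg_right (min_le_right (p i) (p j)) h12
    have h15 : e * (a ^ 2 + b ^ 2) = min (p i) (p j) * (2 / Real.pi ^ 2 * a ^ 2) +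
      min (p i) (p j) * (2 / Real.pi ^ 2 * b ^ 2) := by rw [he]; ring
    linarith
  refine le_trans ?_ h8
  rw [div_mul_eq_mul_div, div_le_iff₀ hK]
  exact (mul_le_mul_of_nonneg_left h6 he0.le).trans_eq (by ring)

lemma exists_quadratic_lower_bound {p : ℕ → ℝ} (hp : ∀ i, 0 ≤ p i) (h : Nonlattice p) :
    ∃ F : Finset ℕ, ∃ c > 0, ∀ u t : ℝ, |u| ≤ Real.pi → |t| ≤ Real.pi → c * (u ^ 2 + t ^ 2) ≤
      ∑ i ∈ F, p i * (1 - Real.cos (u + t * (i - 1))) := by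
  have hterm : ∀ (z : ℝ × ℝ) (i : ℕ), 0 ≤ p i * (1 - Real.cos (z.1 + z.2 * (i - 1))) :=
    fun z i => mul_nonneg (hp i) (by linarith [Real.cos_le_one (z.1 + z.2 * (i - 1))])
  have hcomp : IsCompact (Set.Icc (-Real.pi) Real.pi ×ˢ Set.Icc (-Real.pi) Real.pi) :=
    isCompact_Icc.prod isCompact_Icc
  have key : ∃ F : Finset ℕ, ∃ c > 0,
      ∀ z ∈ Set.Icc (-Real.pi) Real.pi ×ˢ Set.Icc (-Real.pi) Real.pi, c * (z.1 ^ 2 + z.2 ^ 2) ≤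
        ∑ i ∈ F, p i * (1 - Real.cos (z.1 + z.2 * (i - 1))) := by
    refine hcomp.induction_on (p := fun S => ∃ F : Finset ℕ, ∃ c > 0, ∀ z ∈ S,
      c * (z.1 ^ 2 + z.2 ^ 2) ≤ ∑ i ∈ F, p i * (1 - Real.cos (z.1 + z.2 * (i - 1)))) ?_ ?_ ?_ ?_
    · exact ⟨∅, 1, one_pos, by simp⟩
    · rintro S T hST ⟨F, c, hc, hF⟩
      exact ⟨F, c, hc, fun z hz => hF z (hST hz)⟩
    · rintro S T ⟨F, c, hc, hF⟩ ⟨G, e, he, hG⟩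
      refine ⟨F ∪ G, min c e, lt_min hc he, ?_⟩
      rintro z (hz | hz)
      · refine le_trans (mul_le_mul_of_nonneg_right (min_le_left _ _) (by positivity)) ((hF z hz).trans
          (Finset.sum_le_sum_of_subset_of_nonneg Finset.subset_union_left fun i _ _ => hterm z i))
      · refine le_trans (mul_le_mul_of_nonneg_right (min_le_right _ _) (by positivity)) ((hG z hz).trans
          (Finset.sum_le_sum_of_subset_of_nonneg Finset.subset_union_right fun i _ _ => hterm z i))
    · rintro ⟨u, t⟩ ⟨hu, ht⟩
      suffices ∃ F : Finset ℕ, ∃ c > 0, ∀ᶠ z : ℝ × ℝ in 𝓝 (u, t), c * (z.1 ^ 2 + z.2 ^ 2) ≤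
          ∑ i ∈ F, p i * (1 - Real.cos (z.1 + z.2 * (i - 1))) by
        obtain ⟨F, c, hc, hF⟩ := this
        exact ⟨_, mem_nhdsWithin_of_mem_nhds hF, F, c, hc, fun z hz => hz⟩
      by_cases hut : u = 0 ∧ t = 0
      · rw [hut.1, hut.2]
        exact exists_quadratic_lower_bound_nhds_zero h
      · obtain ⟨i, hi, hi'⟩ := h.exists_cos_ne_one (abs_le.2 hu) (abs_le.2 ht) hut
        have hlt : 0 < p i * (1 - Real.cos (u + t * (i - 1))) :=
          mul_pos hi (sub_pos.2 (lt_of_le_of_ne (Real.cos_le_one _) hi'))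
        have hsq : 0 < u ^ 2 + t ^ 2 := by
          by_contra hcon
          exact hut ⟨by nlinarith [sq_nonneg u, sq_nonneg t], by nlinarith [sq_nonneg u, sq_nonneg t]⟩
        refine ⟨{i}, p i * (1 - Real.cos (u + t * (i - 1))) / (2 * (u ^ 2 + t ^ 2)),
          by positivity, ?_⟩
        simp only [Finset.sum_singleton]
        set c := p i * (1 - Real.cos (u + t * (i - 1))) / (2 * (u ^ 2 + t ^ 2)) with hc
        have c1 : Continuous fun z : ℝ × ℝ => c * (z.1 ^ 2 + z.2 ^ 2) := by fun_prop
        have c2 : Continuous fun z : ℝ × ℝ => p i * (1 - Real.cos (z.1 + z.2 * (i - 1))) := by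
          fun_prop
        refine (c1.continuousAt.eventually_lt c2.continuousAt ?_).mono fun z hz => hz.le
        have : c * (u ^ 2 + t ^ 2) = p i * (1 - Real.cos (u + t * (i - 1))) / 2 := by
          rw [hc]; field_simp
        show c * (u ^ 2 + t ^ 2) < p i * (1 - Real.cos (u + t * (i - 1)))
        linarith
  obtain ⟨F, c, hc, hF⟩ := key
  exact ⟨F, c, hc, fun u t hu ht => hF (u, t) ⟨abs_le.1 hu, abs_le.1 ht⟩⟩

lemma eventually_quadratic_le_tsum {nseq : ℕ → (ℕ →₀ ℕ)} {p : ℕ → ℝ} (hc1 : Condition1 nseq p)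
    (h : Nonlattice p) : ∃ c > 0, ∀ᶠ κ in atTop, ∀ u t : ℝ, |u| ≤ Real.pi → |t| ≤ Real.pi →
      c * (u ^ 2 + t ^ 2) ≤
        ∑' i : ℕ, empDist (nseq κ) i * (1 - Real.cos (u + t * ((i : ℝ) - 1))) := by
  obtain ⟨-, -, hp0, -, hp⟩ := hc1
  obtain ⟨F, c, hc, hF⟩ := exists_quadratic_lower_bound hp0 h
  refine ⟨c / 2, by positivity, ?_⟩
  have hev : ∀ᶠ κ in atTop, ∀ i ∈ F, p i / 2 ≤ empDist (nseq κ) i := by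
    rw [eventually_all_finset]
    intro i _
    rcases (hp0 i).eq_or_lt with h0 | h0
    · exact Eventually.of_forall fun κ => by rw [← h0, zero_div]; exact empDist_nonneg _ _
    · exact (hp i).eventually_const_le (half_lt_self h0)
  filter_upwards [hev] with κ hκ u t hu ht
  have hcos : ∀ i : ℕ, 0 ≤ 1 - Real.cos (u + t * ((i : ℝ) - 1)) :=
    fun i => by linarith [Real.cos_le_one (u + t * ((i : ℝ) - 1))]
  refine le_trans ?_ ((summable_empDist_mul (nseq κ) _).sum_le_tsum F
    fun i _ => mul_nonneg (empDist_nonneg _ _) (hcos i))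
  have h1 : ∑ i ∈ F, p i / 2 * (1 - Real.cos (u + t * ((i : ℝ) - 1))) =
      (∑ i ∈ F, p i * (1 - Real.cos (u + t * ((i : ℝ) - 1)))) / 2 := by
    rw [Finset.sum_div]
    exact Finset.sum_congr rfl fun i _ => by ring
  have h2 := Finset.sum_le_sum fun i hi => mul_le_mul_of_nonneg_right (hκ i hi) (hcos i)
  rw [h1] at h2
  have h3 := hF u t hu ht
  linarith

lemma factorial_eq_stirlingSeq {k : ℕ} (hk : 0 < k) : (k.factorial : ℝ) =
    Stirling.stirlingSeq k * (Real.sqrt (2 * k) * (k / Real.exp 1) ^ k) := by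
  have hk' : (0 : ℝ) < k := by exact_mod_cast hk
  have : Real.sqrt (2 * k) * (k / Real.exp 1) ^ k ≠ 0 := by positivity
  rw [Stirling.stirlingSeq, div_mul_cancel₀ _ this]

lemma choose_mul_pow_mul_sqrt {m r : ℕ} (hm : 0 < m) (hr : 0 < r) :
    ((m + r).choose m : ℝ) * (((m : ℝ) / (m + r)) ^ m * ((r : ℝ) / (m + r)) ^ r) *
      Real.sqrt (2 * Real.pi * (m * r / (m + r))) =
    Real.sqrt Real.pi * (Stirling.stirlingSeq (m + r) /
      (Stirling.stirlingSeq m * Stirling.stirlingSeq r)) := by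
  have hm' : (0 : ℝ) < m := by exact_mod_cast hm
  have hr' : (0 : ℝ) < r := by exact_mod_cast hr
  have hpos : ∀ {k : ℕ}, 0 < k → 0 < Stirling.stirlingSeq k := by
    intro k hk
    have : (0 : ℝ) < k := by exact_mod_cast hk
    rw [Stirling.stirlingSeq]; positivity
  have hsm := hpos hm
  have hsr := hpos hr
  have hpi := Real.pi_pos
  have hsqrt : Real.sqrt (2 * ((m + r : ℕ) : ℝ)) * Real.sqrt (2 * Real.pi * (m * r / (m + r))) =
      Real.sqrt Real.pi * (Real.sqrt (2 * m) * Real.sqrt (2 * r)) := by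
    rw [← Real.sqrt_mul (by positivity), ← Real.sqrt_mul (by positivity),
      ← Real.sqrt_mul (by positivity)]
    congr 1
    push_cast
    field_simp
  rw [Nat.cast_choose ℝ (Nat.le_add_right m r), Nat.add_sub_cancel_left,
    factorial_eq_stirlingSeq hm, factorial_eq_stirlingSeq hr,
    factorial_eq_stirlingSeq (Nat.add_pos_left hm r)]
  have h1 : Real.sqrt (2 * m) ≠ 0 := by positivity
  have h2 : Real.sqrt (2 * r) ≠ 0 := by positivity
  have hexp := (Real.exp_pos 1).ne'
  push_cast at hsqrt ⊢
  generalize Real.sqrt (2 * Real.pi * (m * r / (m + r))) = X at hsqrt ⊢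
  simp only [div_pow, pow_add]
  field_simp
  linear_combination (Stirling.stirlingSeq (m + r)) * hsqrt

lemma tendsto_choose_mul_pow_mul_sqrt {m r : ℕ → ℕ} (hm : Tendsto m atTop atTop)
    (hr : Tendsto r atTop atTop) :
    Tendsto (fun κ => ((m κ + r κ).choose (m κ) : ℝ) *
      (((m κ : ℝ) / (m κ + r κ)) ^ m κ * ((r κ : ℝ) / (m κ + r κ)) ^ r κ) *
      Real.sqrt (2 * Real.pi * (m κ * r κ / (m κ + r κ)))) atTop (𝓝 1) := by
  have hs := Stirling.tendsto_stirlingSeq_sqrt_pi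
  have hpi : Real.sqrt Real.pi ≠ 0 := by positivity
  have h1 : Tendsto (fun κ => Real.sqrt Real.pi * (Stirling.stirlingSeq (m κ + r κ) /
      (Stirling.stirlingSeq (m κ) * Stirling.stirlingSeq (r κ)))) atTop
      (𝓝 (Real.sqrt Real.pi * (Real.sqrt Real.pi / (Real.sqrt Real.pi * Real.sqrt Real.pi)))) :=
    ((hs.comp (hm.atTop_add_atTop hr)).div ((hs.comp hm).mul (hs.comp hr))
      (mul_ne_zero hpi hpi)).const_mul _
  have h2 : Real.sqrt Real.pi * (Real.sqrt Real.pi / (Real.sqrt Real.pi * Real.sqrt Real.pi)) = 1 := by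
    field_simp
  rw [h2] at h1
  refine h1.congr' ?_
  filter_upwards [hm.eventually_gt_atTop 0, hr.eventually_gt_atTop 0] with κ h3 h4
  exact (choose_mul_pow_mul_sqrt h3 h4).symm

lemma IsDegStat.sum_degreeSeq_add_one {n : ℕ →₀ ℕ} (hn : IsDegStat n) :
    ∑ j, degreeSeq n j + 1 = (Finsupp.toMultiset n).card := by
  rw [sum_degreeSeq n fun i => i, ← hn.sum_toMultiset, Finsupp.sum_toMultiset]

lemma norm_bernoulliChar_degreeSeq_le {n : ℕ →₀ ℕ} (hn : IsDegStat n) {m : ℕ} {L : ℝ}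
    (hL : L ^ 2 = m * (1 - m / nsize n)) (u t : ℝ) :
    ‖bernoulliChar (degreeSeq n) m (m / nsize n) u t‖ ≤ Real.exp (-(L ^ 2 *
      ∑' i : ℕ, empDist n i * (1 - Real.cos (u + t * ((i : ℝ) - 1))))) := by
  have hN : (0 : ℝ) < nsize n := by exact_mod_cast hn.nsize_pos
  refine (norm_bernoulliChar_le (degreeSeq n) m _ u t).trans_eq ?_
  rw [sum_degreeSeq_eq_tsum hn.nsize_pos fun i : ℕ => 1 - Real.cos (u + t * ((i : ℝ) - 1)), hL]
  congr 2
  field_simp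

lemma norm_bernoulliChar_degreeSeq_sub_le {n : ℕ →₀ ℕ} (hn : IsDegStat n) {m : ℕ}
    (hm : m ≤ nsize n) {L : ℝ} (hL0 : 0 < L) (hL : L ^ 2 = m * (1 - m / nsize n)) (u t : ℝ) :
    ‖bernoulliChar (degreeSeq n) m (m / nsize n) (u / L) (t / L) -
      Complex.exp (Complex.I * (t / L * (1 - m / nsize n) : ℝ)) *
        (Real.exp (-(∑' i : ℕ, empDist n i * (u + t * ((i : ℝ) - 1)) ^ 2) / 2) : ℝ)‖ ≤
      5 * ∑' i : ℕ, empDist n i *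
        ((u + t * ((i : ℝ) - 1)) ^ 2 * min 1 (|u + t * ((i : ℝ) - 1)| / L)) := by
  have hN : (0 : ℝ) < nsize n := by exact_mod_cast hn.nsize_pos
  have hcard := card_toMultiset_eq_nsize n
  have h := norm_bernoulliChar_sub_le (degreeSeq n) hn.sum_degreeSeq_add_one
    (m := m) (by rw [hcard]; exact hn.nsize_pos) (by rw [hcard]; exact hm) (u / L) (t / L)
  rw [congrArg (Nat.cast (R := ℝ)) hcard] at h
  have hy : ∀ x : ℝ, u / L + t / L * (x - 1) = (u + t * (x - 1)) / L := fun x => by ring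
  have hθ : (m : ℝ) / nsize n * (1 - m / nsize n) = L ^ 2 / nsize n := by rw [hL]; ring
  simp only [hy, abs_div, abs_of_pos hL0, hθ] at h
  have e1 := sum_degreeSeq_eq_tsum hn.nsize_pos fun i : ℕ => ((u + t * ((i : ℝ) - 1)) / L) ^ 2 / 2
  have e2 := sum_degreeSeq_eq_tsum hn.nsize_pos fun i : ℕ => ((u + t * ((i : ℝ) - 1)) / L) ^ 2 *
    min 1 (|u + t * ((i : ℝ) - 1)| / L)
  rw [e1, e2] at h
  have e3 : L ^ 2 / nsize n * (nsize n * ∑' i : ℕ, empDist n i *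
      (((u + t * ((i : ℝ) - 1)) / L) ^ 2 / 2)) =
      (∑' i : ℕ, empDist n i * (u + t * ((i : ℝ) - 1)) ^ 2) / 2 := by
    rw [← mul_assoc, div_mul_cancel₀ _ hN.ne', ← tsum_mul_left, ← tsum_div_const]
    refine tsum_congr fun i => ?_
    field_simp
  have e4 : L ^ 2 / nsize n * (nsize n * ∑' i : ℕ, empDist n i *
      (((u + t * ((i : ℝ) - 1)) / L) ^ 2 * min 1 (|u + t * ((i : ℝ) - 1)| / L))) =
      ∑' i : ℕ, empDist n i *
        ((u + t * ((i : ℝ) - 1)) ^ 2 * min 1 (|u + t * ((i : ℝ) - 1)| / L)) := by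
    rw [← mul_assoc, div_mul_cancel₀ _ hN.ne', ← tsum_mul_left]
    refine tsum_congr fun i => ?_
    field_simp
  rw [e3, e4, ← neg_div] at h
  exact h

lemma sq_add_mul_sub_one_le (u t : ℝ) (i : ℕ) :
    |(u + t * ((i : ℝ) - 1)) ^ 2| ≤ (2 * u ^ 2 + 2 * t ^ 2) * (1 + (i : ℝ) ^ 2) := by
  have hi : (0 : ℝ) ≤ i := i.cast_nonneg
  rw [abs_of_nonneg (sq_nonneg _)]
  have h1 : (u + t * ((i : ℝ) - 1)) ^ 2 ≤ 2 * u ^ 2 + 2 * (t ^ 2 * ((i : ℝ) - 1) ^ 2) := by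
    nlinarith [sq_nonneg (u - t * ((i : ℝ) - 1))]
  have h2 : t ^ 2 * ((i : ℝ) - 1) ^ 2 ≤ t ^ 2 * (1 + (i : ℝ) ^ 2) :=
    mul_le_mul_of_nonneg_left (by nlinarith) (sq_nonneg t)
  nlinarith [mul_nonneg (sq_nonneg u) (sq_nonneg (i : ℝ))]

section Moments

variable {nseq : ℕ → (ℕ →₀ ℕ)} {p : ℕ → ℝ}

lemma tsum_mul_sub_one_eq_zero (hc1 : Condition1 nseq p) (hc2 : Condition2 nseq p) :
    ∑' i : ℕ, p i * ((i : ℝ) - 1) = 0 := by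
  have h1 := tendsto_tsum_empDist_mul hc1 hc2 (f := fun _ i => (i : ℝ) - 1)
    (g := fun i => (i : ℝ) - 1) (C := 1)
    (fun _ i => by rw [abs_le]; constructor <;> nlinarith [sq_nonneg ((i : ℝ) - 1)])
    fun i => tendsto_const_nhds
  have h2 : ∀ κ, ∑' i : ℕ, empDist (nseq κ) i * ((i : ℝ) - 1) = -(nsize (nseq κ) : ℝ)⁻¹ := by
    intro κ
    have hdeg := hc1.1 κ
    have hN : (nsize (nseq κ) : ℝ) ≠ 0 := by exact_mod_cast hdeg.nsize_pos.ne'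
    have h3 := sum_degreeSeq_eq_tsum hdeg.nsize_pos fun i : ℕ => (i : ℝ) - 1
    have h4 : (∑ j, (degreeSeq (nseq κ) j : ℝ)) + 1 = nsize (nseq κ) := by
      exact_mod_cast hdeg.sum_degreeSeq_add_one.trans (card_toMultiset_eq_nsize _)
    rw [Finset.sum_sub_distrib, Finset.sum_const, Finset.card_univ, Fintype.card_fin,
      nsmul_eq_mul, mul_one, congrArg (Nat.cast (R := ℝ)) (card_toMultiset_eq_nsize _)] at h3
    have h5 : (nsize (nseq κ) : ℝ) * ∑' i : ℕ, empDist (nseq κ) i * ((i : ℝ) - 1) = -1 := by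
      linarith
    field_simp
    linarith
  simp_rw [h2] at h1
  have h6 : Tendsto (fun κ => -(nsize (nseq κ) : ℝ)⁻¹) atTop (𝓝 (-0)) :=
    (tendsto_inv_atTop_zero.comp (tendsto_natCast_atTop_atTop.comp hc1.2.1)).neg
  rw [neg_zero] at h6
  exact tendsto_nhds_unique h1 h6

lemma summable_mul_of_abs_le (hc1 : Condition1 nseq p) (hc2 : Condition2 nseq p) {f : ℕ → ℝ}
    {C : ℝ} (hf : ∀ i : ℕ, |f i| ≤ C * (1 + (i : ℝ) ^ 2)) : Summable fun i => p i * f i := by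
  obtain ⟨-, -, hp0, hp1, -⟩ := hc1
  refine Summable.of_norm_bounded ((hp1.summable.add hc2.1).mul_left C) fun i => ?_
  rw [Real.norm_eq_abs, abs_mul, abs_of_nonneg (hp0 i)]
  exact (mul_le_mul_of_nonneg_left (hf i) (hp0 i)).trans_eq (by ring)

lemma tendsto_tsum_empDist_mul_sq (hc1 : Condition1 nseq p) (hc2 : Condition2 nseq p) (u t : ℝ) :
    Tendsto (fun κ => ∑' i : ℕ, empDist (nseq κ) i * (u + t * ((i : ℝ) - 1)) ^ 2) atTop
      (𝓝 (u ^ 2 + sigmaSq p * t ^ 2)) := by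
  have h := tendsto_tsum_empDist_mul hc1 hc2 (fun _ i => sq_add_mul_sub_one_le u t i)
    fun i => tendsto_const_nhds
  have s1 : Summable fun i : ℕ => p i * ((i : ℝ) - 1) :=
    summable_mul_of_abs_le hc1 hc2 (C := 1)
      fun i => by rw [abs_le]; constructor <;> nlinarith [sq_nonneg ((i : ℝ) - 1)]
  have s2 : Summable fun i : ℕ => p i * ((i : ℝ) - 1) ^ 2 := by
    simpa using summable_mul_of_abs_le hc1 hc2 (sq_add_mul_sub_one_le 0 1)
  have e : ∀ i : ℕ, p i * (u + t * ((i : ℝ) - 1)) ^ 2 = u ^ 2 * p i +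
      2 * u * t * (p i * ((i : ℝ) - 1)) + t ^ 2 * (p i * ((i : ℝ) - 1) ^ 2) := fun i => by ring
  have hlim : ∑' i : ℕ, p i * (u + t * ((i : ℝ) - 1)) ^ 2 = u ^ 2 + sigmaSq p * t ^ 2 := by
    rw [tsum_congr e, ((hc1.2.2.2.1.summable.mul_left _).add (s1.mul_left _)).tsum_add
      (s2.mul_left _), (hc1.2.2.2.1.summable.mul_left _).tsum_add (s1.mul_left _),
      tsum_mul_left, tsum_mul_left, tsum_mul_left, tsum_mul_sub_one_eq_zero hc1 hc2,
      hc1.2.2.2.1.tsum_eq, sigmaSq]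
    simp_rw [mul_comm (p _)]
    ring
  rwa [hlim] at h

lemma tendsto_tsum_empDist_mul_sq_mul_min (hc1 : Condition1 nseq p) (hc2 : Condition2 nseq p)
    {L : ℕ → ℝ} (hL0 : ∀ κ, 0 ≤ L κ) (hL : Tendsto L atTop atTop) (u t : ℝ) :
    Tendsto (fun κ => ∑' i : ℕ, empDist (nseq κ) i *
      ((u + t * ((i : ℝ) - 1)) ^ 2 * min 1 (|u + t * ((i : ℝ) - 1)| / L κ))) atTop (𝓝 0) := by
  have h := tendsto_tsum_empDist_mul hc1 hc2 (C := 2 * u ^ 2 + 2 * t ^ 2) (g := fun _ => 0)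
    (f := fun κ i => (u + t * ((i : ℝ) - 1)) ^ 2 * min 1 (|u + t * ((i : ℝ) - 1)| / L κ))
    (fun κ i => ?_) fun i => ?_
  · simpa using h
  · have h0 : 0 ≤ min 1 (|u + t * ((i : ℝ) - 1)| / L κ) :=
      le_min zero_le_one (div_nonneg (abs_nonneg _) (hL0 κ))
    rw [abs_mul, abs_of_nonneg h0]
    exact (mul_le_of_le_one_right (abs_nonneg _) (min_le_left _ _)).trans
      (sq_add_mul_sub_one_le u t i)
  · have h1 : Tendsto (fun κ => |u + t * ((i : ℝ) - 1)| / L κ) atTop (𝓝 0) :=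
      hL.const_div_atTop _
    simpa using ((tendsto_const_nhds (x := (1 : ℝ))).min h1).const_mul
      ((u + t * ((i : ℝ) - 1)) ^ 2)

lemma sigmaSq_pos (hc1 : Condition1 nseq p) (hc2 : Condition2 nseq p) (h : Nonlattice p) :
    0 < sigmaSq p := by
  obtain ⟨i, j, hij, hi, hj⟩ := h.exists_ne
  have s2 : Summable fun i : ℕ => ((i : ℝ) - 1) ^ 2 * p i := by
    simpa [mul_comm] using summable_mul_of_abs_le hc1 hc2 (sq_add_mul_sub_one_le 0 1)
  have key : ∀ k : ℕ, k ≠ 1 → 0 < p k → 0 < sigmaSq p := fun k hk hpk => by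
    refine s2.tsum_pos (fun i => mul_nonneg (sq_nonneg _) (hc1.2.2.1 i)) k (mul_pos ?_ hpk)
    have : (k : ℝ) - 1 ≠ 0 := sub_ne_zero.2 (by exact_mod_cast hk)
    positivity
  by_cases h1 : i = 1
  · exact key j (fun h => hij (h1.trans h.symm)) hj
  · exact key i h1 hi

end Moments

lemma integral_gaussian_prod {s : ℝ} (hs : 0 < s) :
    ∫ z : ℝ × ℝ, ((Real.exp (-(z.1 ^ 2 + s * z.2 ^ 2) / 2) : ℝ) : ℂ) =
      ((2 * Real.pi / Real.sqrt s : ℝ) : ℂ) := by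
  have h : ∀ z : ℝ × ℝ, Real.exp (-(z.1 ^ 2 + s * z.2 ^ 2) / 2) =
      Real.exp (-(1 / 2) * z.1 ^ 2) * Real.exp (-(s / 2) * z.2 ^ 2) := fun z => by
    rw [← Real.exp_add]; congr 1; ring
  rw [integral_complex_ofReal]
  congr 1
  simp_rw [h]
  rw [Measure.volume_eq_prod, integral_prod_mul (fun x : ℝ => Real.exp (-(1 / 2) * x ^ 2))
    fun x : ℝ => Real.exp (-(s / 2) * x ^ 2), integral_gaussian, integral_gaussian,
    ← Real.sqrt_mul (by positivity), show 2 * Real.pi / Real.sqrt s =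
      Real.sqrt ((2 * Real.pi) ^ 2 / s) by
        rw [Real.sqrt_div (by positivity), Real.sqrt_sq (by positivity)]]
  congr 1
  field_simp

lemma integrable_exp_neg_mul_add_sq {c : ℝ} (hc : 0 < c) :
    Integrable fun z : ℝ × ℝ => Real.exp (-(c * (z.1 ^ 2 + z.2 ^ 2))) := by
  have h := (integrable_exp_neg_mul_sq hc).mul_prod (integrable_exp_neg_mul_sq hc)
  rw [← Measure.volume_eq_prod] at h
  refine h.congr (Eventually.of_forall fun z => ?_)
  show _ * _ = _
  rw [← Real.exp_add]
  congr 1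
  ring

section LocalLimit

variable {nseq : ℕ → (ℕ →₀ ℕ)} {p : ℕ → ℝ} {m : ℕ → ℕ} {L : ℕ → ℝ}

lemma tendsto_bernoulliChar (hc1 : Condition1 nseq p) (hc2 : Condition2 nseq p)
    (hm : ∀ κ, m κ ≤ nsize (nseq κ)) (hL0 : ∀ κ, 0 ≤ L κ)
    (hL : ∀ κ, L κ ^ 2 = m κ * (1 - m κ / nsize (nseq κ))) (hLinf : Tendsto L atTop atTop)
    (u t : ℝ) :
    Tendsto (fun κ => bernoulliChar (degreeSeq (nseq κ)) (m κ) (m κ / nsize (nseq κ))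
      (u / L κ) (t / L κ)) atTop (𝓝 ((Real.exp (-(u ^ 2 + sigmaSq p * t ^ 2) / 2) : ℝ) : ℂ)) := by
  have h1 : Tendsto (fun κ => t / L κ * (1 - m κ / nsize (nseq κ))) atTop (𝓝 0) := by
    refine squeeze_zero_norm (fun κ => ?_) (hLinf.const_div_atTop |t|)
    rw [Real.norm_eq_abs, abs_mul, abs_div, abs_of_nonneg (hL0 κ)]
    refine mul_le_of_le_one_right (div_nonneg (abs_nonneg _) (hL0 κ)) ?_
    have h2 : (m κ : ℝ) / nsize (nseq κ) ≤ 1 :=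
      div_le_one_of_le₀ (by exact_mod_cast hm κ) (Nat.cast_nonneg _)
    have h3 : 0 ≤ (m κ : ℝ) / nsize (nseq κ) := by positivity
    rw [abs_le]
    constructor <;> linarith
  have h2 : Tendsto (fun κ => Complex.exp (Complex.I *
      (t / L κ * (1 - m κ / nsize (nseq κ)) : ℝ))) atTop (𝓝 1) := by
    have hcont : Continuous fun x : ℝ => Complex.exp (Complex.I * x) := by fun_prop
    have := (hcont.tendsto 0).comp h1
    simp only [Complex.ofReal_zero, mul_zero, Complex.exp_zero] at this
    exact this
  have h3 : Tendsto (fun κ => ((Real.exp (-(∑' i : ℕ, empDist (nseq κ) i *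
      (u + t * ((i : ℝ) - 1)) ^ 2) / 2) : ℝ) : ℂ)) atTop
      (𝓝 ((Real.exp (-(u ^ 2 + sigmaSq p * t ^ 2) / 2) : ℝ) : ℂ)) := by
    have hcont : Continuous fun x : ℝ => ((Real.exp (-x / 2) : ℝ) : ℂ) := by fun_prop
    exact (hcont.tendsto _).comp (tendsto_tsum_empDist_mul_sq hc1 hc2 u t)
  have h4 := h2.mul h3
  rw [one_mul] at h4
  refine tendsto_of_tendsto_of_dist h4 ?_
  refine squeeze_zero' (Eventually.of_forall fun κ => dist_nonneg) ?_
    (by simpa using (tendsto_tsum_empDist_mul_sq_mul_min hc1 hc2 hL0 hLinf u t).const_mul 5)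
  filter_upwards [hLinf.eventually_gt_atTop 0] with κ hκ
  rw [dist_comm, dist_eq_norm]
  exact norm_bernoulliChar_degreeSeq_sub_le (hc1.1 κ) (hm κ) hκ (hL κ) u t

lemma tendsto_setIntegral_bernoulliChar (hc1 : Condition1 nseq p) (hc2 : Condition2 nseq p)
    (hnl : Nonlattice p) (hm : ∀ κ, m κ ≤ nsize (nseq κ)) (hL0 : ∀ κ, 0 ≤ L κ)
    (hL : ∀ κ, L κ ^ 2 = m κ * (1 - m κ / nsize (nseq κ))) (hLinf : Tendsto L atTop atTop) :
    Tendsto (fun κ => ∫ z in Set.Ioc (-(Real.pi * L κ)) (Real.pi * L κ) ×ˢ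
        Set.Ioc (-(Real.pi * L κ)) (Real.pi * L κ), bernoulliChar (degreeSeq (nseq κ)) (m κ)
        (m κ / nsize (nseq κ)) (z.1 / L κ) (z.2 / L κ)) atTop
      (𝓝 ((2 * Real.pi / Real.sqrt (sigmaSq p) : ℝ) : ℂ)) := by
  obtain ⟨c, hc, hbound⟩ := eventually_quadratic_le_tsum hc1 hnl
  have hmeas : ∀ κ, MeasurableSet (Set.Ioc (-(Real.pi * L κ)) (Real.pi * L κ) ×ˢ
      Set.Ioc (-(Real.pi * L κ)) (Real.pi * L κ)) := fun κ => measurableSet_Ioc.prod measurableSet_Ioc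
  rw [← integral_gaussian_prod (sigmaSq_pos hc1 hc2 hnl)]
  simp_rw [← integral_indicator (hmeas _)]
  refine tendsto_integral_filter_of_dominated_convergence
    (fun z => Real.exp (-(c * (z.1 ^ 2 + z.2 ^ 2)))) ?_ ?_ (integrable_exp_neg_mul_add_sq hc) ?_
  · refine Eventually.of_forall fun κ => ?_
    refine AEStronglyMeasurable.indicator ?_ (hmeas κ)
    exact ((continuous_bernoulliChar _ _ _).comp
      (f := fun z : ℝ × ℝ => (z.1 / L κ, z.2 / L κ)) (by fun_prop)).aestronglyMeasurable
  · filter_upwards [hbound, hLinf.eventually_gt_atTop 0] with κ hκ hLκ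
    refine Eventually.of_forall fun z => ?_
    by_cases hz : z ∈ Set.Ioc (-(Real.pi * L κ)) (Real.pi * L κ) ×ˢ
        Set.Ioc (-(Real.pi * L κ)) (Real.pi * L κ)
    · rw [Set.indicator_of_mem hz]
      refine (norm_bernoulliChar_degreeSeq_le (hc1.1 κ) (hL κ) _ _).trans (Real.exp_le_exp.2 ?_)
      have habs : ∀ x ∈ Set.Ioc (-(Real.pi * L κ)) (Real.pi * L κ), |x / L κ| ≤ Real.pi := by
        intro x hx
        rw [abs_div, abs_of_pos hLκ, div_le_iff₀ hLκ, abs_le]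
        exact ⟨hx.1.le, hx.2⟩
      have h := mul_le_mul_of_nonneg_left (hκ _ _ (habs _ hz.1) (habs _ hz.2)) (sq_nonneg (L κ))
      have e : L κ ^ 2 * (c * ((z.1 / L κ) ^ 2 + (z.2 / L κ) ^ 2)) = c * (z.1 ^ 2 + z.2 ^ 2) := by
        field_simp
      rw [e] at h
      exact neg_le_neg h
    · rw [Set.indicator_of_notMem hz, norm_zero]
      exact (Real.exp_pos _).le
  · refine Eventually.of_forall fun z => ?_
    refine (tendsto_bernoulliChar hc1 hc2 hm hL0 hL hLinf z.1 z.2).congr' ?_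
    have hpiL : Tendsto (fun κ => Real.pi * L κ) atTop atTop :=
      hLinf.const_mul_atTop Real.pi_pos
    filter_upwards [hpiL.eventually_gt_atTop |z.1|, hpiL.eventually_gt_atTop |z.2|] with κ h1 h2
    rw [Set.indicator_of_mem]
    exact ⟨⟨(abs_lt.1 h1).1, (abs_lt.1 h1).2.le⟩, ⟨(abs_lt.1 h2).1, (abs_lt.1 h2).2.le⟩⟩

/-- Local limit theorem for sampling without replacement from a degree sequence. -/
lemma tendsto_sampleProb_mul (hc1 : Condition1 nseq p) (hc2 : Condition2 nseq p)
    (hnl : Nonlattice p) (hm : ∀ κ, m κ ≤ nsize (nseq κ)) (hminf : Tendsto m atTop atTop)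
    (hnminf : Tendsto (fun κ => nsize (nseq κ) - m κ) atTop atTop) :
    Tendsto (fun κ => sampleProb (degreeSeq (nseq κ)) (m κ) * (Real.sqrt (2 * Real.pi) *
      Real.sqrt (sigmaSq p) * Real.sqrt (m κ * (1 - m κ / nsize (nseq κ))))) atTop (𝓝 1) := by
  set V : ℕ → ℝ := fun κ => m κ * (1 - m κ / nsize (nseq κ)) with hV
  have hN : ∀ κ, (0 : ℝ) < nsize (nseq κ) := fun κ => by exact_mod_cast (hc1.1 κ).nsize_pos
  have hV0 : ∀ κ, 0 ≤ V κ := fun κ => by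
    have : (m κ : ℝ) / nsize (nseq κ) ≤ 1 := (div_le_one (hN κ)).2 (by exact_mod_cast hm κ)
    exact mul_nonneg (Nat.cast_nonneg _) (by linarith)
  have hadd : ∀ κ, (nsize (nseq κ) : ℝ) = m κ + (nsize (nseq κ) - m κ : ℕ) := fun κ => by
    rw [Nat.cast_sub (hm κ)]; ring
  have hVeq : ∀ κ, V κ = m κ * (nsize (nseq κ) - m κ : ℕ) /
      (m κ + (nsize (nseq κ) - m κ : ℕ)) := fun κ => by
    have h1 := hadd κ
    rw [← h1]
    have h2 := (hN κ).ne'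
    simp only [hV]
    field_simp
    linear_combination (m κ : ℝ) * h1
  have hVinf : Tendsto V atTop atTop := by
    have h1 : Tendsto (fun κ => ((m κ : ℝ))⁻¹ + ((nsize (nseq κ) - m κ : ℕ) : ℝ)⁻¹) atTop
        (𝓝[>] 0) := by
      rw [tendsto_nhdsWithin_iff]
      constructor
      · simpa using (tendsto_inv_atTop_zero.comp (tendsto_natCast_atTop_atTop.comp hminf)).add
          (tendsto_inv_atTop_zero.comp
            ((tendsto_natCast_atTop_atTop (R := ℝ)).comp hnminf))
      · filter_upwards [hminf.eventually_gt_atTop 0] with κ h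
        have h' : (0 : ℝ) < m κ := by exact_mod_cast h
        exact Set.mem_Ioi.2 (by positivity)
    refine h1.inv_tendsto_nhdsGT_zero.congr' ?_
    filter_upwards [hminf.eventually_gt_atTop 0, hnminf.eventually_gt_atTop 0] with κ h2 h3
    have h2' : (0 : ℝ) < m κ := by exact_mod_cast h2
    have h3' : (0 : ℝ) < (nsize (nseq κ) - m κ : ℕ) := by exact_mod_cast h3
    rw [hVeq, Pi.inv_apply]
    generalize ((nsize (nseq κ) - m κ : ℕ) : ℝ) = r at h3' ⊢
    field_simp
    ring
  set L : ℕ → ℝ := fun κ => Real.sqrt (V κ) with hLdef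
  have hL : ∀ κ, L κ ^ 2 = m κ * (1 - m κ / nsize (nseq κ)) := fun κ => Real.sq_sqrt (hV0 κ)
  have hLinf : Tendsto L atTop atTop := Real.tendsto_sqrt_atTop.comp hVinf
  have hint := (Complex.continuous_re.tendsto _).comp (tendsto_setIntegral_bernoulliChar hc1 hc2 hnl
    hm (fun κ => Real.sqrt_nonneg (V κ)) hL hLinf)
  have hst := tendsto_choose_mul_pow_mul_sqrt hminf hnminf
  have hlim := hint.div hst one_ne_zero
  rw [Complex.ofReal_re, div_one] at hlim
  have hσ : Real.sqrt (sigmaSq p) ≠ 0 := (Real.sqrt_pos.2 (sigmaSq_pos hc1 hc2 hnl)).ne'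
  have hpi := Real.pi_pos
  have hlim2 := hlim.mul_const (Real.sqrt (sigmaSq p) / (2 * Real.pi))
  have e1 : 2 * Real.pi / Real.sqrt (sigmaSq p) * (Real.sqrt (sigmaSq p) / (2 * Real.pi)) = 1 := by
    field_simp
  rw [e1] at hlim2
  refine hlim2.congr' ?_
  filter_upwards [hminf.eventually_gt_atTop 0, hnminf.eventually_gt_atTop 0] with κ h2 h3
  have h2' : (0 : ℝ) < m κ := by exact_mod_cast h2
  have h3' : (0 : ℝ) < (nsize (nseq κ) - m κ : ℕ) := by exact_mod_cast h3
  have hVpos : 0 < V κ := by rw [hVeq]; positivity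
  have hLpos : 0 < L κ := Real.sqrt_pos.2 hVpos
  have hcard := card_toMultiset_eq_nsize (nseq κ)
  have hθ : 1 - (m κ : ℝ) / nsize (nseq κ) =
      ((nsize (nseq κ) - m κ : ℕ) : ℝ) / nsize (nseq κ) := by
    rw [Nat.cast_sub (hm κ), sub_div, div_self (hN κ).ne']
  have hC : ((nsize (nseq κ)).choose (m κ) : ℝ) ≠ 0 := by
    exact_mod_cast (Nat.choose_pos (hm κ)).ne'
  have hX : ((m κ : ℝ) / nsize (nseq κ)) ^ m κ * (((nsize (nseq κ) - m κ : ℕ) : ℝ) /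
      nsize (nseq κ)) ^ (nsize (nseq κ) - m κ) ≠ 0 := by
    have := hN κ
    positivity
  simp only [Pi.div_apply, Function.comp_apply]
  rw [integral_bernoulliChar _ _ _ hLpos, Complex.ofReal_re, sampleProb, ← hVeq, ← hadd,
    Nat.add_sub_cancel' (hm κ),
    show (Finsupp.toMultiset (nseq κ)).card - m κ = nsize (nseq κ) - m κ by rw [hcard],
    show (Finsupp.toMultiset (nseq κ)).card.choose (m κ) = (nsize (nseq κ)).choose (m κ) by
      rw [hcard],
    show (m κ : ℝ) * (1 - m κ / nsize (nseq κ)) = V κ from rfl, hθ,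
    Real.sqrt_mul (by positivity : 0 ≤ 2 * Real.pi)]
  have h4 : Real.sqrt (2 * Real.pi) ^ 2 = 2 * Real.pi := Real.sq_sqrt (by positivity)
  have h5 : Real.sqrt (2 * Real.pi) ≠ 0 := by positivity
  have h6 : Real.sqrt (V κ) = L κ := rfl
  generalize Real.sqrt (2 * Real.pi) = s at h4 h5 ⊢
  rw [h6, ← h4]
  generalize ((m κ : ℝ) / nsize (nseq κ)) ^ m κ * (((nsize (nseq κ) - m κ : ℕ) : ℝ) /
      nsize (nseq κ)) ^ (nsize (nseq κ) - m κ) = X at hX ⊢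
  have hL0 := hLpos.ne'
  field_simp

end LocalLimit

section Regimes

variable {N M : ℕ → ℝ}

lemma rpow_two_thirds_ratio {x y : ℝ} (hx : 0 < x) (hy : 0 ≤ y) :
    (y / x ^ ((2 : ℝ) / 3)) ^ ((3 : ℝ) / 2) = y ^ ((3 : ℝ) / 2) / x := by
  rw [Real.div_rpow hy (by positivity), ← Real.rpow_mul hx.le]
  norm_num

lemma tendsto_sqrt_mul_rpow_nhdsGT_zero (hN : ∀ κ, 0 < N κ) (hM : ∀ κ, 0 < M κ)
    (hlt : ∀ᶠ κ in atTop, M κ < N κ)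
    (h : Tendsto (fun κ => M κ / N κ ^ ((2 : ℝ) / 3)) atTop (𝓝 0)) :
    Tendsto (fun κ => Real.sqrt (1 - M κ / N κ) * (M κ ^ ((3 : ℝ) / 2) / N κ)) atTop (𝓝[>] 0) := by
  rw [tendsto_nhdsWithin_iff]
  constructor
  · have h1 := h.rpow_const (p := (3 : ℝ) / 2) (Or.inr (by norm_num))
    rw [Real.zero_rpow (by norm_num)] at h1
    refine squeeze_zero (fun κ => ?_) (fun κ => ?_) h1
    · have := hN κ; have := hM κ; positivity
    · rw [rpow_two_thirds_ratio (hN κ) (hM κ).le]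
      have h2 := hN κ
      have h3 := hM κ
      refine mul_le_of_le_one_left (by positivity) (Real.sqrt_le_one.2 ?_)
      have : 0 < M κ / N κ := by positivity
      linarith
  · filter_upwards [hlt] with κ hκ
    have h2 := hN κ
    have h3 := hM κ
    have h4 : 0 < 1 - M κ / N κ := sub_pos.2 ((div_lt_one h2).2 hκ)
    exact Set.mem_Ioi.2 (by positivity)

lemma tendsto_sqrt_mul_rpow_nhds (hN : ∀ κ, 0 < N κ) (hM : ∀ κ, 0 < M κ)
    (hNinf : Tendsto N atTop atTop) {a : ℝ}
    (h : Tendsto (fun κ => M κ / N κ ^ ((2 : ℝ) / 3)) atTop (𝓝 a)) :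
    Tendsto (fun κ => Real.sqrt (1 - M κ / N κ) * (M κ ^ ((3 : ℝ) / 2) / N κ)) atTop
      (𝓝 (a ^ ((3 : ℝ) / 2))) := by
  have h1 := h.rpow_const (p := (3 : ℝ) / 2) (Or.inr (by norm_num))
  have h2 : Tendsto (fun κ => M κ / N κ) atTop (𝓝 0) := by
    have h3 := h.mul ((tendsto_rpow_neg_atTop (by norm_num : (0 : ℝ) < 1 / 3)).comp hNinf)
    rw [mul_zero] at h3
    refine h3.congr fun κ => ?_
    have h4 := hN κ
    rw [Function.comp_apply, Real.rpow_neg h4.le, ← div_eq_mul_inv, div_div,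
      ← Real.rpow_add h4]
    norm_num
  have h5 := ((h2.const_sub 1).sqrt).mul h1
  rw [sub_zero, Real.sqrt_one, one_mul] at h5
  exact h5.congr fun κ => by rw [rpow_two_thirds_ratio (hN κ) (hM κ).le]

lemma tendsto_sqrt_mul_rpow_atTop (hN : ∀ κ, 0 < N κ) (hM : ∀ κ, 0 < M κ)
    (hsub : Tendsto (fun κ => N κ - M κ) atTop atTop)
    (h : Tendsto (fun κ => M κ / N κ ^ ((2 : ℝ) / 3)) atTop atTop) :
    Tendsto (fun κ => Real.sqrt (1 - M κ / N κ) * (M κ ^ ((3 : ℝ) / 2) / N κ)) atTop atTop := by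
  have h1 : Tendsto (fun κ => M κ ^ ((3 : ℝ) / 2) / N κ) atTop atTop :=
    ((tendsto_rpow_atTop (by norm_num : (0 : ℝ) < 3 / 2)).comp h).congr fun κ => by
      rw [Function.comp_apply, rpow_two_thirds_ratio (hN κ) (hM κ).le]
  refine tendsto_atTop.2 fun C => ?_
  filter_upwards [h1.eventually_ge_atTop (2 * |C|), hsub.eventually_ge_atTop (8 * C ^ 2)]
    with κ h2 h3
  have hn := hN κ
  have hm := hM κ
  have h4 : 0 ≤ M κ ^ ((3 : ℝ) / 2) / N κ := by positivity
  have h6 : (M κ ^ ((3 : ℝ) / 2) / N κ) ^ 2 = M κ ^ 3 / N κ ^ 2 := by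
    rw [div_pow, ← Real.rpow_natCast (M κ ^ ((3 : ℝ) / 2)), ← Real.rpow_mul hm.le,
      ← Real.rpow_natCast (M κ) 3]
    norm_num
  have h7 : 0 ≤ 1 - M κ / N κ := by
    rw [sub_nonneg, div_le_one hn]
    nlinarith [sq_nonneg C]
  refine le_trans (le_abs_self C) (abs_le_of_sq_le_sq' ?_ (by positivity)).2
  rw [sq_abs, mul_pow, Real.sq_sqrt h7]
  rcases le_total (N κ) (2 * M κ) with h8 | h8
  · rw [h6]
    have e : (1 - M κ / N κ) * (M κ ^ 3 / N κ ^ 2) = (N κ - M κ) * (M κ / N κ) ^ 3 := by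
      field_simp
    have h9 : (1 / 2 : ℝ) ≤ M κ / N κ := by rw [le_div_iff₀ hn]; linarith
    have h10 : (1 / 2 : ℝ) ^ 3 ≤ (M κ / N κ) ^ 3 := pow_le_pow_left₀ (by norm_num) h9 3
    rw [e]
    nlinarith [sq_nonneg C]
  · have h9 : (1 / 2 : ℝ) ≤ 1 - M κ / N κ := by
      have : M κ / N κ ≤ 1 / 2 := by rw [div_le_iff₀ hn]; linarith
      linarith
    have h10 : (2 * |C|) ^ 2 ≤ (M κ ^ ((3 : ℝ) / 2) / N κ) ^ 2 :=
      pow_le_pow_left₀ (by positivity) h2 2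
    rw [mul_pow, sq_abs] at h10
    nlinarith [sq_nonneg C]

end Regimes

/-- Lemma 6.1: asymptotics of the expected number of fringe trees of a given (growing) size. -/
theorem expect_countSize_asymptotics
    (nseq : ℕ → (ℕ →₀ ℕ)) (p : ℕ → ℝ) (m : ℕ → ℕ)
    (hcond1 : Condition1 nseq p) (hcond2 : Condition2 nseq p) (hnl : Nonlattice p)
    (hm : ∀ κ, 1 ≤ m κ ∧ m κ ≤ nsize (nseq κ))
    (hminf : Tendsto m atTop atTop)
    (hnminf : Tendsto (fun κ => nsize (nseq κ) - m κ) atTop atTop) :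
    Tendsto (fun κ =>
        expect (nseq κ) (PlaneTree.countSize (m κ)) /
          ((nsize (nseq κ) : ℝ) /
            (Real.sqrt (2 * Real.pi) * Real.sqrt (sigmaSq p) *
              Real.sqrt (1 - (m κ : ℝ) / (nsize (nseq κ) : ℝ)) *
              (m κ : ℝ) ^ ((3 : ℝ) / 2))))
      atTop (𝓝 1) ∧
    (Tendsto (fun κ => (m κ : ℝ) / (nsize (nseq κ) : ℝ) ^ ((2 : ℝ) / 3)) atTop (𝓝 0) →
      Tendsto (fun κ => expect (nseq κ) (PlaneTree.countSize (m κ))) atTop atTop) ∧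
    (∀ a : ℝ, 0 < a →
      Tendsto (fun κ => (m κ : ℝ) / (nsize (nseq κ) : ℝ) ^ ((2 : ℝ) / 3)) atTop (𝓝 a) →
      Tendsto (fun κ => expect (nseq κ) (PlaneTree.countSize (m κ))) atTop
        (𝓝 ((Real.sqrt (2 * Real.pi * sigmaSq p * a ^ 3))⁻¹))) ∧
    (Tendsto (fun κ => (m κ : ℝ) / (nsize (nseq κ) : ℝ) ^ ((2 : ℝ) / 3)) atTop atTop →
      Tendsto (fun κ => expect (nseq κ) (PlaneTree.countSize (m κ))) atTop (𝓝 0)) := by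
  have hdeg := hcond1.1
  have hN : ∀ κ, (0 : ℝ) < nsize (nseq κ) := fun κ => by exact_mod_cast (hdeg κ).nsize_pos
  have hM : ∀ κ, (0 : ℝ) < m κ := fun κ => by exact_mod_cast (hm κ).1
  have hlt : ∀ᶠ κ in atTop, (m κ : ℝ) < nsize (nseq κ) := by
    filter_upwards [hnminf.eventually_gt_atTop 0] with κ h
    exact_mod_cast Nat.lt_of_sub_pos h
  have hNinf : Tendsto (fun κ => (nsize (nseq κ) : ℝ)) atTop atTop :=
    tendsto_natCast_atTop_atTop.comp hcond1.2.1
  have hsub : Tendsto (fun κ => (nsize (nseq κ) : ℝ) - m κ) atTop atTop :=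
    ((tendsto_natCast_atTop_atTop (R := ℝ)).comp hnminf).congr fun κ => by
      rw [Function.comp_apply, Nat.cast_sub (hm κ).2]
  have hσ : 0 < Real.sqrt (sigmaSq p) := Real.sqrt_pos.2 (sigmaSq_pos hcond1 hcond2 hnl)
  have hπ : 0 < Real.sqrt (2 * Real.pi) := Real.sqrt_pos.2 (by positivity)
  have hratio : Tendsto (fun κ => expect (nseq κ) (PlaneTree.countSize (m κ)) /
      ((nsize (nseq κ) : ℝ) / (Real.sqrt (2 * Real.pi) * Real.sqrt (sigmaSq p) *
        Real.sqrt (1 - (m κ : ℝ) / (nsize (nseq κ) : ℝ)) * (m κ : ℝ) ^ ((3 : ℝ) / 2))))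
      atTop (𝓝 1) := by
    refine (tendsto_sampleProb_mul hcond1 hcond2 hnl (fun κ => (hm κ).2) hminf hnminf).congr
      fun κ => ?_
    have h1 := (hN κ).ne'
    have h2 := (hM κ).ne'
    rw [expect_countSize_eq _ (hdeg κ) _ (hm κ).1 (hm κ).2, Real.sqrt_mul (hM κ).le,
      show (3 : ℝ) / 2 = 1 + 1 / 2 by norm_num, Real.rpow_add (hM κ), Real.rpow_one,
      ← Real.sqrt_eq_rpow]
    generalize Real.sqrt (1 - (m κ : ℝ) / (nsize (nseq κ) : ℝ)) = y
    generalize Real.sqrt (m κ) = z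
    rw [div_div_eq_mul_div]
    field_simp
  have hprod : ∀ᶠ κ in atTop, expect (nseq κ) (PlaneTree.countSize (m κ)) /
      ((nsize (nseq κ) : ℝ) / (Real.sqrt (2 * Real.pi) * Real.sqrt (sigmaSq p) *
        Real.sqrt (1 - (m κ : ℝ) / (nsize (nseq κ) : ℝ)) * (m κ : ℝ) ^ ((3 : ℝ) / 2))) *
      ((Real.sqrt (1 - (m κ : ℝ) / nsize (nseq κ)) *
          ((m κ : ℝ) ^ ((3 : ℝ) / 2) / nsize (nseq κ)))⁻¹ *
        (Real.sqrt (2 * Real.pi) * Real.sqrt (sigmaSq p))⁻¹) =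
      expect (nseq κ) (PlaneTree.countSize (m κ)) := by
    filter_upwards [hlt] with κ hκ
    have h1 := (hN κ).ne'
    have h2 : (m κ : ℝ) ^ ((3 : ℝ) / 2) ≠ 0 := (Real.rpow_pos_of_pos (hM κ) _).ne'
    have h3 : Real.sqrt (1 - (m κ : ℝ) / nsize (nseq κ)) ≠ 0 :=
      (Real.sqrt_pos.2 (sub_pos.2 ((div_lt_one (hN κ)).2 hκ))).ne'
    generalize Real.sqrt (1 - (m κ : ℝ) / nsize (nseq κ)) = y at h3 ⊢
    generalize (m κ : ℝ) ^ ((3 : ℝ) / 2) = z at h2 ⊢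
    field_simp
  refine ⟨hratio, fun h => ?_, fun a ha h => ?_, fun h => ?_⟩
  · refine (Tendsto.congr' hprod) (hratio.pos_mul_atTop one_pos ?_)
    exact (tendsto_sqrt_mul_rpow_nhdsGT_zero hN hM hlt h).inv_tendsto_nhdsGT_zero.atTop_mul_const
      (by positivity)
  · have ha' : a ^ ((3 : ℝ) / 2) ≠ 0 := (Real.rpow_pos_of_pos ha _).ne'
    have h1 := hratio.mul (((tendsto_sqrt_mul_rpow_nhds hN hM hNinf h).inv₀ ha').mul_const
      (Real.sqrt (2 * Real.pi) * Real.sqrt (sigmaSq p))⁻¹)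
    refine Tendsto.congr' hprod ?_
    have e : Real.sqrt (a ^ 3) = a ^ ((3 : ℝ) / 2) := by
      rw [Real.sqrt_eq_rpow, ← Real.rpow_natCast a 3, ← Real.rpow_mul ha.le]
      norm_num
    have e' : (Real.sqrt (2 * Real.pi * sigmaSq p * a ^ 3))⁻¹ = 1 * ((a ^ ((3 : ℝ) / 2))⁻¹ *
        (Real.sqrt (2 * Real.pi) * Real.sqrt (sigmaSq p))⁻¹) := by
      rw [Real.sqrt_mul' _ (by positivity : 0 ≤ a ^ 3),
        Real.sqrt_mul (by positivity : 0 ≤ 2 * Real.pi), e, mul_inv_rev, one_mul]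
    rw [e']
    exact h1
  · refine Tendsto.congr' hprod ?_
    have h1 := hratio.mul ((tendsto_sqrt_mul_rpow_atTop hN hM hsub h).inv_tendsto_atTop.mul_const
      (Real.sqrt (2 * Real.pi) * Real.sqrt (sigmaSq p))⁻¹)
    simpa only [zero_mul, mul_zero, Pi.inv_apply] using h1
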